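/- arXiv:1712.06241 — 12 statements merged into one kernel-verified Lean document; each statement's English description precedes it below -/
import Mathlib

section
/- The scalar map Q̄ admits at least one positive fixed point provided L > 1. More precisely: assume in addition that there exists z* > 0 such that h is nondecreasing on [0, z*] and nonincreasing on [z*, ∞) and h(z) → 0 as z → ∞. If L > 1, then there exists z > 0 with Q̄(z) = z. -/
open Real MeasureTheory Set Filter Topology

theorem aux_fixed (a b r : ℝ) (hab : a ≤ b) (hr : 0 < r) (w c h : ℝ → ℝ)
    (hw : Continuous w) (hc : Continuous c) (hh : ContDiff ℝ 1 h) (hh0 : h 0 = 0)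
    (hw0 : ∀ s ∈ Icc a b, 0 ≤ w s) (hc0 : ∀ s ∈ Icc a b, 0 ≤ c s)
    (hc1 : ∀ s ∈ Icc a b, c s ≤ 1)
    (M : ℝ) (hM : ∀ x, 0 ≤ x → h x ≤ M)
    (hI : r < deriv h 0 * ∫ s in a..b, w s * c s) :
    ∃ z > 0, ∫ s in a..b, w s * h (z * c s) = r * z := by
  have hhc : Continuous h := hh.continuous
  set I := ∫ s in a..b, w s * c s with hIdef
  have hI0 : 0 ≤ I := intervalIntegral.integral_nonneg hab
    (fun s hs => mul_nonneg (hw0 s hs) (hc0 s hs))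
  have hIpos : 0 < I := by
    rcases hI0.eq_or_lt with h0 | h0
    · rw [← h0] at hI; linarith [mul_zero (deriv h 0)]
    · exact h0
  have hη : r / I < deriv h 0 := by rwa [div_lt_iff₀ hIpos]
  have hcont : Continuous (fun z => (∫ s in a..b, w s * h (z * c s)) - r * z) := by
    refine Continuous.sub ?_ (by fun_prop)
    apply intervalIntegral.continuous_parametric_intervalIntegral_of_continuous'
    simp only [Function.uncurry_def]
    fun_prop
  have hd : HasDerivAt h (deriv h 0) 0 := (hh.differentiable (by norm_num) 0).hasDerivAt
  have hev : ∀ᶠ x in 𝓝[>] (0:ℝ), r / I * x ≤ h x := by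
    have h1 := (hasDerivAt_iff_tendsto_slope.1 hd).mono_left
      (nhdsWithin_mono (0:ℝ) (fun x (hx : x ∈ Ioi (0:ℝ)) => (ne_of_gt hx : x ∈ ({0}ᶜ : Set ℝ))))
    filter_upwards [h1.eventually (lt_mem_nhds hη), self_mem_nhdsWithin] with x hx hx0
    have hx0' : 0 < x := hx0
    rw [slope_def_field, hh0, sub_zero, sub_zero, lt_div_iff₀ hx0'] at hx
    exact hx.le
  obtain ⟨δ, hδ, hδ'⟩ := (mem_nhdsGT_iff_exists_Ioc_subset.1 hev)
  have hδ0 : 0 < δ := hδ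
  have hlow : 0 ≤ (∫ s in a..b, w s * h (δ * c s)) - r * δ := by
    have : ∫ s in a..b, (r / I * δ) * (w s * c s) ≤ ∫ s in a..b, w s * h (δ * c s) := by
      apply intervalIntegral.integral_mono_on hab
      · exact Continuous.intervalIntegrable (by fun_prop) _ _
      · exact Continuous.intervalIntegrable (by fun_prop) _ _
      · intro s hs
        have key : r / I * (δ * c s) ≤ h (δ * c s) := by
          rcases (hc0 s hs).eq_or_lt with h0 | h0
          · rw [← h0]; simp [hh0]
          · exact hδ' ⟨mul_pos hδ0 h0, by nlinarith [hc1 s hs]⟩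
        calc _ = w s * (r / I * (δ * c s)) := by ring
          _ ≤ _ := mul_le_mul_of_nonneg_left key (hw0 s hs)
    rw [intervalIntegral.integral_const_mul, ← hIdef] at this
    have e : r / I * δ * I = r * δ := by field_simp
    linarith
  set W := ∫ s in a..b, w s * M with hW
  set Z := max δ (W / r) with hZ
  have hZδ : δ ≤ Z := le_max_left _ _
  have hup : (∫ s in a..b, w s * h (Z * c s)) - r * Z ≤ 0 := by
    have : ∫ s in a..b, w s * h (Z * c s) ≤ W := by
      apply intervalIntegral.integral_mono_on hab
      · exact Continuous.intervalIntegrable (by fun_prop) _ _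
      · exact Continuous.intervalIntegrable (by fun_prop) _ _
      · intro s hs
        exact mul_le_mul_of_nonneg_left
          (hM _ (mul_nonneg (hδ0.le.trans hZδ) (hc0 s hs))) (hw0 s hs)
    have h2 : W / r ≤ Z := le_max_right _ _
    rw [div_le_iff₀ hr] at h2
    linarith
  obtain ⟨z, hz, hz'⟩ := intermediate_value_Icc' hZδ hcont.continuousOn ⟨hup, hlow⟩
  exact ⟨z, hδ0.trans_le hz.1, by simpa [sub_eq_zero] using hz'⟩

/-- If `L > 1` (and `h` is unimodal with `h(z) → 0` as `z → ∞`),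
then the scalar Poincaré map `Q̄` admits at least one positive fixed point. -/
theorem scalar_map_has_positive_fixed_point
    (T α β tα tβ : ℝ)
    (hα : 0 < α) (hαβ : α ≤ β) (hβtα : β < tα) (htαβ : tα ≤ tβ) (htβT : tβ < T)
    (dM dI : ℝ → ℝ) (hdMc : Continuous dM) (hdMpos : ∀ s, 0 < dM s)
    (hdIc : Continuous dI) (hdIpos : ∀ s, 0 < dI s)
    (τ : ℝ → ℝ) (hτ : ContDiff ℝ 1 τ) (hτ' : ∀ s, deriv τ s < 1)
    (hτα : tα - τ tα = α) (hτβ : tβ - τ tβ = β)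
    (hτr : ∀ s ∈ Icc tα tβ, α ≤ s - τ s ∧ s - τ s ≤ β)
    (p : ℝ → ℝ) (hpc : Continuous p) (hpnn : ∀ s, 0 ≤ p s)
    (h : ℝ → ℝ) (hh : ContDiff ℝ 1 h) (hh0 : h 0 = 0) (hhnn : ∀ z, 0 ≤ z → 0 ≤ h z)
    (kM : ℝ → ℝ → ℝ) (hkM : ∀ t s, kM t s = Real.exp (-∫ ς in s..t, dM ς))
    (ε : ℝ → ℝ) (hε : ∀ s, ε s = Real.exp (-∫ ς in (s - τ s)..s, dI ς))
    (Qbar : ℝ → ℝ)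
    (hQ : ∀ z, Qbar z = z * kM T 0
      + ∫ s in tα..tβ, kM T s * (1 - deriv τ s) * ε s * p (s - τ s)
          * h (z * kM (s - τ s) 0))
    (L : ℝ)
    (hL : L = kM T 0 / (1 - kM T 0)
      * ∫ s in tα..tβ, (1 - deriv τ s) * ε s * p (s - τ s) * deriv h 0
          / kM s (s - τ s))
    (zstar : ℝ) (hzstar : 0 < zstar)
    (hmono : MonotoneOn h (Icc 0 zstar)) (hanti : AntitoneOn h (Ici zstar))
    (hlim : Tendsto h atTop (nhds 0))
    (hL1 : 1 < L) :
    ∃ z > 0, Qbar z = z := by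
  have hint : ∀ a b, IntervalIntegrable dM volume a b := fun a b => hdMc.intervalIntegrable a b
  have hintI : ∀ a b, IntervalIntegrable dI volume a b := fun a b => hdIc.intervalIntegrable a b
  have hG : Continuous (fun t => ∫ x in (0:ℝ)..t, dM x) :=
    intervalIntegral.continuous_primitive hint 0
  have hGI : Continuous (fun t => ∫ x in (0:ℝ)..t, dI x) :=
    intervalIntegral.continuous_primitive hintI 0
  have hkG : ∀ t s, kM t s = Real.exp (-((∫ x in (0:ℝ)..t, dM x) - ∫ x in (0:ℝ)..s, dM x)) := by
    intro t s
    rw [hkM, intervalIntegral.integral_interval_sub_left (hint _ _) (hint _ _)]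
  have hεG : ε = fun s => Real.exp (-((∫ x in (0:ℝ)..s, dI x) - ∫ x in (0:ℝ)..(s - τ s), dI x)) := by
    funext s
    rw [hε, intervalIntegral.integral_interval_sub_left (hintI _ _) (hintI _ _)]
  have hτc : Continuous τ := hτ.continuous
  have hτ'c : Continuous (deriv τ) := hτ.continuous_deriv le_rfl
  have hsτ : Continuous (fun s => s - τ s) := by fun_prop
  have hεc : Continuous ε := by
    rw [hεG]
    have := hGI.comp hsτ
    simp only [Function.comp_def] at this
    exact Real.continuous_exp.comp ((hGI.sub this).neg)
  have hkTc : Continuous (fun s => kM T s) := by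
    simp only [hkG]; exact Real.continuous_exp.comp ((continuous_const.sub hG).neg)
  have hk0c : Continuous (fun s => kM s 0) := by
    simp only [hkG]; exact Real.continuous_exp.comp ((hG.sub continuous_const).neg)
  have hkpos : ∀ t s, 0 < kM t s := fun t s => by rw [hkM]; exact Real.exp_pos _
  have hk1 : kM T 0 < 1 := by
    rw [hkM, Real.exp_lt_one_iff, neg_lt_zero]
    exact intervalIntegral.intervalIntegral_pos_of_pos (hint _ _) hdMpos (by linarith)
  have hM : ∀ x, 0 ≤ x → h x ≤ h zstar := by
    intro x hx
    rcases le_total x zstar with hxz | hxz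
    · exact hmono ⟨hx, hxz⟩ ⟨hzstar.le, le_rfl⟩ hxz
    · exact hanti self_mem_Ici hxz hxz
  have hr : 0 < 1 - kM T 0 := by linarith
  obtain ⟨z, hz, hz'⟩ := aux_fixed tα tβ (1 - kM T 0) htαβ hr
    (fun s => kM T s * (1 - deriv τ s) * ε s * p (s - τ s)) (fun s => kM (s - τ s) 0) h
    (((hkTc.mul (continuous_const.sub hτ'c)).mul hεc).mul (hpc.comp hsτ))
    (hk0c.comp hsτ) hh hh0
    (fun s _ => mul_nonneg (mul_nonneg (mul_nonneg (hkpos _ _).le (by linarith [hτ' s]))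
      (by rw [hε]; exact (Real.exp_pos _).le)) (hpnn _))
    (fun s _ => (hkpos _ _).le)
    (fun s hs => by
      have h1 := (hτr s hs).1
      have : 0 ≤ ∫ ς in (0:ℝ)..(s - τ s), dM ς :=
        intervalIntegral.integral_nonneg (by linarith) (fun u _ => (hdMpos u).le)
      simp only [hkM]
      rw [Real.exp_le_one_iff]; linarith)
    (h zstar) hM
    (by
      rw [hL, div_mul_eq_mul_div, lt_div_iff₀ hr, one_mul,
        ← intervalIntegral.integral_const_mul] at hL1
      rw [← intervalIntegral.integral_const_mul]
      refine hL1.trans_eq (intervalIntegral.integral_congr fun s _ => ?_)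
      have e : kM T s * kM (s - τ s) 0 * kM s (s - τ s) = kM T 0 := by
        simp only [hkG, ← Real.exp_add]; congr 1; ring
      have := (hkpos s (s - τ s)).ne'
      rw [← e]
      field_simp)
  refine ⟨z, hz, ?_⟩
  rw [hQ, hz']; ring
end

section
/- Assume there exists z* > 0 such that h is nondecreasing on [0, z*] and nonincreasing on [z*, ∞) and h(z) → 0 as z → ∞, and assume L > 1, so that Q̄ has positive fixed points; let u* denote the minimal positive fixed point. If u*·k̄_M(α,0) ≤ z*, then for every u ∈ (0, u*] the iterates satisfy Q̄ⁿ(u) → u* as n → ∞. -/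
open Real MeasureTheory Set Filter Topology

lemma aux_abs (a b k K zs us d : ℝ) (hab : a ≤ b) (W κ h Q : ℝ → ℝ)
    (hW : Continuous W) (hκ : Continuous κ) (hh : Continuous h)
    (hWnn : ∀ s, 0 ≤ W s) (hκpos : ∀ s, 0 < κ s) (hκK : ∀ s ∈ Icc a b, κ s ≤ K)
    (hK : 0 < K) (hk : 0 ≤ k)
    (hQ : ∀ z, Q z = z * k + ∫ s in a..b, W s * h (z * κ s))
    (hd : HasDerivAt h d 0) (h0 : h 0 = 0) (hmono : MonotoneOn h (Icc 0 zs))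
    (h1 : 1 < k + d * ∫ s in a..b, W s * κ s)
    (hupos : 0 < us) (hufix : Q us = us) (humin : ∀ z, 0 < z → Q z = z → us ≤ z)
    (hcond : us * K ≤ zs) :
    ∀ u, 0 < u → u ≤ us → Tendsto (fun n => Q^[n] u) atTop (nhds us) := by
  have hQc : Continuous Q := by
    have : Q = fun z => z * k + ∫ s in a..b, W s * h (z * κ s) := funext hQ
    rw [this]
    refine (continuous_id.mul continuous_const).add ?_
    apply intervalIntegral.continuous_parametric_intervalIntegral_of_continuous'
    simp only [Function.uncurry_def]
    fun_prop
  have hQm : ∀ x y, 0 ≤ x → x ≤ y → y ≤ us → Q x ≤ Q y := by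
    intro x y hx hxy hy
    rw [hQ, hQ]
    refine add_le_add (mul_le_mul_of_nonneg_right hxy hk) ?_
    apply intervalIntegral.integral_mono_on hab
      (Continuous.intervalIntegrable (by fun_prop) _ _)
      (Continuous.intervalIntegrable (by fun_prop) _ _)
    intro s hs
    have e1 : x * κ s ≤ y * κ s := mul_le_mul_of_nonneg_right hxy (hκpos s).le
    have e2 : y * κ s ≤ us * K := mul_le_mul hy (hκK s hs) (hκpos s).le hupos.le
    have e0 : 0 ≤ x * κ s := mul_nonneg hx (hκpos s).le
    exact mul_le_mul_of_nonneg_left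
      (hmono ⟨e0, by linarith⟩ ⟨by linarith, by linarith⟩ e1) (hWnn s)
  have hsmall : ∃ r > 0, ∀ z, 0 < z → z < r → z < Q z := by
    set J := ∫ s in a..b, W s * κ s with hJ
    have hJnn : 0 ≤ J :=
      intervalIntegral.integral_nonneg hab (fun s _ => mul_nonneg (hWnn s) (hκpos s).le)
    set δ := (k + d * J - 1) / (J + 1) with hδ
    have hδpos : 0 < δ := div_pos (by linarith) (by linarith)
    have hδJ : δ * J < k + d * J - 1 := by
      have : δ * (J + 1) = k + d * J - 1 := div_mul_cancel₀ _ (by linarith)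
      nlinarith
    have hlo := (hasDerivAt_iff_isLittleO.1 hd).def hδpos
    obtain ⟨η, hη, hb⟩ := Metric.eventually_nhds_iff.1 hlo
    have hb' : ∀ x, 0 ≤ x → x < η → (d - δ) * x ≤ h x := by
      intro x hx hxη
      have := hb (y := x) (by simpa [abs_of_nonneg hx] using hxη)
      simp only [h0, sub_zero, smul_eq_mul, Real.norm_eq_abs, abs_of_nonneg hx] at this
      have := (abs_le.1 this).1
      linarith
    refine ⟨η / K, div_pos hη hK, fun z hz hzr => ?_⟩
    rw [hQ]
    have hzK : z * K < η := (lt_div_iff₀ hK).1 hzr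
    have : (∫ s in a..b, (z * (d - δ)) * (W s * κ s)) ≤ ∫ s in a..b, W s * h (z * κ s) := by
      apply intervalIntegral.integral_mono_on hab
        (Continuous.intervalIntegrable (by fun_prop) _ _)
        (Continuous.intervalIntegrable (by fun_prop) _ _)
      intro s hs
      have e2 : z * κ s ≤ z * K := mul_le_mul_of_nonneg_left (hκK s hs) hz.le
      have := mul_le_mul_of_nonneg_left
        (hb' (z * κ s) (mul_nonneg hz.le (hκpos s).le) (by linarith)) (hWnn s)
      linarith
    rw [intervalIntegral.integral_const_mul, ← hJ] at this
    nlinarith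
  obtain ⟨r, hr, hsm⟩ := hsmall
  have habove : ∀ z, 0 < z → z ≤ us → z ≤ Q z := by
    intro z hz hzu
    by_contra hc
    push Not at hc
    set w := min z r / 2 with hw
    have hwpos : 0 < w := by have := lt_min hz hr; linarith
    have hwz : w < z := by have := min_le_left z r; linarith
    have hwr : w < r := by have := min_le_right z r; linarith
    have hivt := intermediate_value_Icc' (f := fun x => Q x - x) hwz.le
      ((hQc.sub continuous_id).continuousOn)
    obtain ⟨c, hcm, hc0⟩ := hivt (show (0:ℝ) ∈ _ from
      ⟨by show Q z - z ≤ 0; linarith, by have := hsm w hwpos hwr; show 0 ≤ Q w - w; linarith⟩)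
    have hc1 : Q c = c := by simp only at hc0; linarith
    have := humin c (by linarith [hcm.1]) hc1
    have : c = z := le_antisymm hcm.2 (by linarith)
    subst this
    linarith
  intro u hu huu
  have hinv : ∀ n, u ≤ Q^[n] u ∧ Q^[n] u ≤ us := by
    intro n
    induction n with
    | zero => exact ⟨le_rfl, huu⟩
    | succ n ih =>
      rw [Function.iterate_succ_apply']
      refine ⟨ih.1.trans (habove _ (by linarith [ih.1]) ih.2), ?_⟩
      have := hQm _ us (by linarith [ih.1]) ih.2 le_rfl
      rwa [hufix] at this
  have hmon : Monotone (fun n => Q^[n] u) := by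
    apply monotone_nat_of_le_succ
    intro n
    rw [Function.iterate_succ_apply']
    exact habove _ (by linarith [(hinv n).1]) (hinv n).2
  have hbdd : BddAbove (range (fun n => Q^[n] u)) :=
    ⟨us, by rintro _ ⟨n, rfl⟩; exact (hinv n).2⟩
  have ht := tendsto_atTop_ciSup hmon hbdd
  set l := ⨆ n, Q^[n] u with hl
  have hlf : Q l = l := isFixedPt_of_tendsto_iterate ht hQc.continuousAt
  have hul : u ≤ l := ge_of_tendsto' ht (fun n => (hinv n).1)
  have hlu : l ≤ us := le_of_tendsto' ht (fun n => (hinv n).2)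
  have : l = us := le_antisymm hlu (humin l (by linarith) hlf)
  rwa [this] at ht

/-- If `u*` is the minimal positive fixed point of `Q̄` and
`u* · k̄_M(α,0) ≤ z*`, then `Q̄ⁿ(u) → u*` for every `u ∈ (0, u*]`. -/
theorem scalar_map_iterates_converge_to_minimal_fixed_point
    (T α β tα tβ : ℝ)
    (hα : 0 < α) (hαβ : α ≤ β) (hβtα : β < tα) (htαβ : tα ≤ tβ) (htβT : tβ < T)
    (dM dI : ℝ → ℝ) (hdMc : Continuous dM) (hdMpos : ∀ s, 0 < dM s)
    (hdIc : Continuous dI) (hdIpos : ∀ s, 0 < dI s)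
    (τ : ℝ → ℝ) (hτ : ContDiff ℝ 1 τ) (hτ' : ∀ s, deriv τ s < 1)
    (hτα : tα - τ tα = α) (hτβ : tβ - τ tβ = β)
    (hτr : ∀ s ∈ Icc tα tβ, α ≤ s - τ s ∧ s - τ s ≤ β)
    (p : ℝ → ℝ) (hpc : Continuous p) (hpnn : ∀ s, 0 ≤ p s)
    (h : ℝ → ℝ) (hh : ContDiff ℝ 1 h) (hh0 : h 0 = 0) (hhnn : ∀ z, 0 ≤ z → 0 ≤ h z)
    (kM : ℝ → ℝ → ℝ) (hkM : ∀ t s, kM t s = Real.exp (-∫ ς in s..t, dM ς))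
    (ε : ℝ → ℝ) (hε : ∀ s, ε s = Real.exp (-∫ ς in (s - τ s)..s, dI ς))
    (Qbar : ℝ → ℝ)
    (hQ : ∀ z, Qbar z = z * kM T 0
      + ∫ s in tα..tβ, kM T s * (1 - deriv τ s) * ε s * p (s - τ s)
          * h (z * kM (s - τ s) 0))
    (L : ℝ)
    (hL : L = kM T 0 / (1 - kM T 0)
      * ∫ s in tα..tβ, (1 - deriv τ s) * ε s * p (s - τ s) * deriv h 0
          / kM s (s - τ s))
    (zstar : ℝ) (hzstar : 0 < zstar)
    (hmono : MonotoneOn h (Icc 0 zstar)) (hanti : AntitoneOn h (Ici zstar))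
    (hlim : Tendsto h atTop (nhds 0))
    (hL1 : 1 < L)
    (ustar : ℝ) (hupos : 0 < ustar) (hufix : Qbar ustar = ustar)
    (humin : ∀ z, 0 < z → Qbar z = z → ustar ≤ z)
    (hcond : ustar * kM α 0 ≤ zstar) :
    ∀ u, 0 < u → u ≤ ustar →
      Tendsto (fun n => Qbar^[n] u) atTop (nhds ustar) := by
  obtain ⟨G, hG⟩ : ∃ G : ℝ → ℝ, G = fun t => ∫ ς in (0:ℝ)..t, dM ς := ⟨_, rfl⟩
  obtain ⟨H, hH⟩ : ∃ H : ℝ → ℝ, H = fun t => ∫ ς in (0:ℝ)..t, dI ς := ⟨_, rfl⟩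
  have hGc : Continuous G := by
    rw [hG]; exact intervalIntegral.continuous_primitive (fun a b => hdMc.intervalIntegrable a b) 0
  have hHc : Continuous H := by
    rw [hH]; exact intervalIntegral.continuous_primitive (fun a b => hdIc.intervalIntegrable a b) 0
  have hG0 : G 0 = 0 := by simp [hG]
  have hGd : ∀ s t, ∫ ς in s..t, dM ς = G t - G s := by
    intro s t
    rw [hG]
    exact (intervalIntegral.integral_interval_sub_left (hdMc.intervalIntegrable _ _)
      (hdMc.intervalIntegrable _ _)).symm
  have hHd : ∀ s t, ∫ ς in s..t, dI ς = H t - H s := by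
    intro s t
    rw [hH]
    exact (intervalIntegral.integral_interval_sub_left (hdIc.intervalIntegrable _ _)
      (hdIc.intervalIntegrable _ _)).symm
  have hGm : ∀ s t, s ≤ t → G s ≤ G t := by
    intro s t hst
    have : 0 ≤ ∫ ς in s..t, dM ς :=
      intervalIntegral.integral_nonneg hst (fun x _ => (hdMpos x).le)
    rw [hGd] at this
    linarith
  have hGT : 0 < G T := by
    have : 0 < ∫ ς in (0:ℝ)..T, dM ς :=
      intervalIntegral.intervalIntegral_pos_of_pos (hdMc.intervalIntegrable _ _) hdMpos
        (by linarith)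
    rw [hGd] at this
    linarith
  have hk : ∀ t s, kM t s = Real.exp (G s - G t) := by
    intro t s; rw [hkM, hGd]; congr 1; ring
  have he : ∀ s, ε s = Real.exp (H (s - τ s) - H s) := by
    intro s; rw [hε, hHd]; congr 1; ring
  have hτc : Continuous τ := hτ.continuous
  have hτdc : Continuous (deriv τ) := hτ.continuous_deriv le_rfl
  have hk1 : kM T 0 < 1 := by
    rw [hk, hG0]; exact Real.exp_lt_one_iff.2 (by linarith)
  have hkpos : ∀ t s, 0 < kM t s := fun t s => by rw [hk]; exact Real.exp_pos _
  have hWc : Continuous (fun s => kM T s * (1 - deriv τ s) * ε s * p (s - τ s)) := by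
    simp only [hk, he]; fun_prop
  have hκc : Continuous (fun s => kM (s - τ s) 0) := by
    simp only [hk]; fun_prop
  refine aux_abs tα tβ (kM T 0) (kM α 0) zstar ustar (deriv h 0) htαβ
    (fun s => kM T s * (1 - deriv τ s) * ε s * p (s - τ s)) (fun s => kM (s - τ s) 0) h Qbar
    hWc hκc hh.continuous ?_ (fun s => hkpos _ _) ?_ (hkpos _ _) (hkpos _ _).le hQ
    ((hh.differentiable (by norm_num)) 0).hasDerivAt hh0 hmono ?_ hupos hufix humin hcond
  · intro s
    have h1 : 0 ≤ 1 - deriv τ s := by linarith [hτ' s]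
    have h2 : 0 ≤ ε s := by rw [he]; exact (Real.exp_pos _).le
    exact mul_nonneg (mul_nonneg (mul_nonneg (hkpos _ _).le h1) h2) (hpnn _)
  · intro s hs
    show kM (s - τ s) 0 ≤ kM α 0
    rw [hk, hk]
    exact Real.exp_le_exp.2 (by linarith [hGm _ _ (hτr s hs).1])
  · have hkey : deriv h 0 * (∫ s in tα..tβ, kM T s * (1 - deriv τ s) * ε s * p (s - τ s)
        * kM (s - τ s) 0) = (1 - kM T 0) * L := by
      rw [hL, ← mul_assoc, mul_div_cancel₀ _ (by linarith : (1 - kM T 0) ≠ 0),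
        ← intervalIntegral.integral_const_mul, ← intervalIntegral.integral_const_mul]
      congr 1
      funext s
      have : kM T s * kM (s - τ s) 0 = kM T 0 / kM s (s - τ s) := by
        simp only [hk]
        rw [← Real.exp_add, ← Real.exp_sub]
        congr 1; ring
      calc _ = (kM T s * kM (s - τ s) 0) *
            ((1 - deriv τ s) * ε s * p (s - τ s) * deriv h 0) := by ring
        _ = _ := by rw [this]; ring
    show 1 < kM T 0 + deriv h 0 * (∫ s in tα..tβ, kM T s * (1 - deriv τ s) * ε s * p (s - τ s)
        * kM (s - τ s) 0)
    rw [hkey]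
    nlinarith
end

section
/- Assume h is sublinear, i.e. h(λz) ≥ λh(z) for all λ ∈ (0,1) and z ≥ 0 (equivalently h(z) ≤ h'(0)z for all z ≥ 0). If L < 1, then Q̄(z) ≤ (k̄_M(T,0) + (1 − k̄_M(T,0))L)·z for every z ≥ 0, where the factor k̄_M(T,0) + (1 − k̄_M(T,0))L lies in (0,1); consequently Q̄ⁿ(z) → 0 as n → ∞ for every z ≥ 0. -/
open Real MeasureTheory Set Filter Topology

/-- If `h` is sublinear and `L < 1`, then `Q̄(z) ≤ (k̄_M(T,0) + (1 − k̄_M(T,0))L)·z`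
for all `z ≥ 0`, the contraction factor lies in `(0,1)`, and `Q̄ⁿ(z) → 0` for every `z ≥ 0`. -/
theorem scalar_map_extinction_when_L_lt_one
    (T α β tα tβ : ℝ)
    (hα : 0 < α) (hαβ : α ≤ β) (hβtα : β < tα) (htαβ : tα ≤ tβ) (htβT : tβ < T)
    (dM dI : ℝ → ℝ) (hdMc : Continuous dM) (hdMpos : ∀ s, 0 < dM s)
    (hdIc : Continuous dI) (hdIpos : ∀ s, 0 < dI s)
    (τ : ℝ → ℝ) (hτ : ContDiff ℝ 1 τ) (hτ' : ∀ s, deriv τ s < 1)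
    (hτα : tα - τ tα = α) (hτβ : tβ - τ tβ = β)
    (hτr : ∀ s ∈ Icc tα tβ, α ≤ s - τ s ∧ s - τ s ≤ β)
    (p : ℝ → ℝ) (hpc : Continuous p) (hpnn : ∀ s, 0 ≤ p s)
    (h : ℝ → ℝ) (hh : ContDiff ℝ 1 h) (hh0 : h 0 = 0) (hhnn : ∀ z, 0 ≤ z → 0 ≤ h z)
    (hsub : ∀ lam ∈ Ioo (0:ℝ) 1, ∀ z, 0 ≤ z → lam * h z ≤ h (lam * z))
    (kM : ℝ → ℝ → ℝ) (hkM : ∀ t s, kM t s = Real.exp (-∫ ς in s..t, dM ς))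
    (ε : ℝ → ℝ) (hε : ∀ s, ε s = Real.exp (-∫ ς in (s - τ s)..s, dI ς))
    (Qbar : ℝ → ℝ)
    (hQ : ∀ z, Qbar z = z * kM T 0
      + ∫ s in tα..tβ, kM T s * (1 - deriv τ s) * ε s * p (s - τ s)
          * h (z * kM (s - τ s) 0))
    (L : ℝ)
    (hL : L = kM T 0 / (1 - kM T 0)
      * ∫ s in tα..tβ, (1 - deriv τ s) * ε s * p (s - τ s) * deriv h 0
          / kM s (s - τ s))
    (hL1 : L < 1) :
    (∀ z, 0 ≤ z → Qbar z ≤ (kM T 0 + (1 - kM T 0) * L) * z) ∧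
    (kM T 0 + (1 - kM T 0) * L ∈ Ioo (0:ℝ) 1) ∧
    (∀ z, 0 ≤ z → Tendsto (fun n => Qbar^[n] z) atTop (nhds 0)) := by
  have hlin : ∀ z, 0 ≤ z → h z ≤ deriv h 0 * z := by
    intro z hz
    have hd0 : HasDerivAt h (deriv h 0) (0 * z) := by
      rw [zero_mul]
      exact ((hh.differentiable (by norm_num)) 0).hasDerivAt
    have hd1 : HasDerivAt (fun l : ℝ => l * z) z 0 := by
      simpa using (hasDerivAt_id (0:ℝ)).mul_const z
    have hd : HasDerivAt (fun l : ℝ => h (l * z)) (deriv h 0 * z) 0 :=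
      HasDerivAt.comp (0:ℝ) hd0 hd1
    have ht := hd.tendsto_slope_zero_right
    refine ge_of_tendsto ht ?_
    filter_upwards [Ioo_mem_nhdsGT (show (0:ℝ) < 1 by norm_num)] with l hl
    have := hsub l hl z hz
    simp only [zero_add, zero_mul, hh0, sub_zero, smul_eq_mul]
    rw [inv_mul_eq_div, le_div_iff₀ hl.1]
    linarith
  have hd0 : 0 ≤ deriv h 0 := by
    have h1 := hlin 1 zero_le_one
    have h2 := hhnn 1 zero_le_one
    linarith
  have hiM : ∀ a b, IntervalIntegrable dM volume a b := fun a b => hdMc.intervalIntegrable a b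
  have hiI : ∀ a b, IntervalIntegrable dI volume a b := fun a b => hdIc.intervalIntegrable a b
  obtain ⟨F, hF⟩ : ∃ F : ℝ → ℝ, F = fun t => ∫ ς in (0:ℝ)..t, dM ς := ⟨_, rfl⟩
  obtain ⟨G, hG⟩ : ∃ G : ℝ → ℝ, G = fun t => ∫ ς in (0:ℝ)..t, dI ς := ⟨_, rfl⟩
  have hFc : Continuous F := by
    rw [hF]; exact intervalIntegral.continuous_primitive hiM 0
  have hGc : Continuous G := by
    rw [hG]; exact intervalIntegral.continuous_primitive hiI 0
  have hk : ∀ t s, kM t s = Real.exp (F s - F t) := by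
    intro t s
    rw [hkM, hF]
    congr 1
    have := intervalIntegral.integral_interval_sub_left (hiM 0 t) (hiM 0 s)
    simp only
    linarith
  have he : ∀ s, ε s = Real.exp (G (s - τ s) - G s) := by
    intro s
    rw [hε, hG]
    congr 1
    have := intervalIntegral.integral_interval_sub_left (hiI 0 s) (hiI 0 (s - τ s))
    simp only
    linarith
  have hKpos : 0 < kM T 0 := by rw [hk]; exact Real.exp_pos _
  have hK1 : kM T 0 < 1 := by
    rw [hkM, Real.exp_lt_one_iff, neg_lt_zero]
    exact intervalIntegral.intervalIntegral_pos_of_pos (hiM 0 T) hdMpos (by linarith)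
  have hτc : Continuous τ := hτ.continuous
  have hτdc : Continuous (deriv τ) := hτ.continuous_deriv (by norm_num)
  have hhc : Continuous h := hh.continuous
  obtain ⟨I, hI⟩ : ∃ I, I = ∫ s in tα..tβ, (1 - deriv τ s) * ε s * p (s - τ s) * deriv h 0
          / kM s (s - τ s) := ⟨_, rfl⟩
  rw [← hI] at hL
  have hw : ∀ s, 0 ≤ (1 - deriv τ s) * ε s * p (s - τ s) := by
    intro s
    have h1 : 0 ≤ 1 - deriv τ s := by linarith [hτ' s]
    have h2 : 0 ≤ ε s := by rw [hε]; exact (Real.exp_pos _).le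
    exact mul_nonneg (mul_nonneg h1 h2) (hpnn _)
  have hkp : ∀ t s, 0 < kM t s := fun t s => by rw [hk]; exact Real.exp_pos _
  have hI0 : 0 ≤ I := by
    rw [hI]
    exact intervalIntegral.integral_nonneg htαβ
      (fun s _ => div_nonneg (mul_nonneg (hw s) hd0) (hkp _ _).le)
  have hLI : (1 - kM T 0) * L = kM T 0 * I := by
    have : (1 - kM T 0) ≠ 0 := by linarith
    rw [hL]; field_simp
  have hfac : kM T 0 + (1 - kM T 0) * L ∈ Ioo (0:ℝ) 1 := by
    constructor
    · rw [hLI]; positivity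
    · nlinarith
  have hbound : ∀ z, 0 ≤ z → Qbar z ≤ (kM T 0 + (1 - kM T 0) * L) * z := by
    intro z hz
    rw [hQ, hLI]
    have key : (∫ s in tα..tβ, kM T s * (1 - deriv τ s) * ε s * p (s - τ s)
          * h (z * kM (s - τ s) 0)) ≤ ∫ s in tα..tβ, (kM T 0 * z) *
          ((1 - deriv τ s) * ε s * p (s - τ s) * deriv h 0 / kM s (s - τ s)) := by
      apply intervalIntegral.integral_mono_on htαβ
      · apply Continuous.intervalIntegrable
        simp only [hk, he]
        fun_prop
      · apply Continuous.intervalIntegrable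
        simp only [hk, he]
        fun_prop (disch := intros; exact (Real.exp_pos _).ne')
      · intro s _
        have h1 := hlin (z * kM (s - τ s) 0) (mul_nonneg hz (hkp _ _).le)
        have h2 : kM T 0 / kM s (s - τ s) = kM T s * kM (s - τ s) 0 := by
          simp only [hk]
          rw [← Real.exp_sub, ← Real.exp_add]
          congr 1; ring
        calc _ = (kM T s * ((1 - deriv τ s) * ε s * p (s - τ s))) * h (z * kM (s - τ s) 0) := by
              ring
          _ ≤ (kM T s * ((1 - deriv τ s) * ε s * p (s - τ s)))
                * (deriv h 0 * (z * kM (s - τ s) 0)) :=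
              mul_le_mul_of_nonneg_left h1 (mul_nonneg (hkp _ _).le (hw s))
          _ = (kM T s * kM (s - τ s) 0) * z * ((1 - deriv τ s) * ε s * p (s - τ s) * deriv h 0) := by
              ring
          _ = _ := by rw [← h2]; ring
    rw [intervalIntegral.integral_const_mul, ← hI] at key
    linarith
  have hQnn : ∀ z, 0 ≤ z → 0 ≤ Qbar z := by
    intro z hz
    rw [hQ]
    refine add_nonneg (mul_nonneg hz hKpos.le) (intervalIntegral.integral_nonneg htαβ ?_)
    intro s _
    have h1 := mul_nonneg (mul_nonneg (hkp T s).le (hw s))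
      (hhnn (z * kM (s - τ s) 0) (mul_nonneg hz (hkp _ _).le))
    calc (0:ℝ) ≤ _ := h1
      _ = _ := by ring
  refine ⟨hbound, hfac, ?_⟩
  intro z hz
  generalize kM T 0 + (1 - kM T 0) * L = c at hfac hbound
  have hit : ∀ n : ℕ, 0 ≤ Qbar^[n] z ∧ Qbar^[n] z ≤ c ^ n * z := by
    intro n
    induction n with
    | zero => simpa using hz
    | succ n ih =>
      rw [Function.iterate_succ_apply']
      refine ⟨hQnn _ ih.1, (hbound _ ih.1).trans ?_⟩
      calc c * Qbar^[n] z ≤ c * (c ^ n * z) := mul_le_mul_of_nonneg_left ih.2 hfac.1.le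
        _ = _ := by ring
  have hlim : Tendsto (fun n : ℕ => c ^ n * z) atTop (nhds 0) := by
    simpa using (tendsto_pow_atTop_nhds_zero_of_lt_one hfac.1.le hfac.2).mul_const z
  exact squeeze_zero (fun n => (hit n).1) (fun n => (hit n).2) hlim
end

section
/- For every μ ∈ ℝ, ∫_ℝ e^{μy}𝒦(y) dy = exp(∫_0^T (μ²D_M(ς) − d_M(ς)) dς) + ∫_{t_α}^{t_β} c(s) · exp( (∫_s^T + ∫_0^{s−τ(s)}) (μ²D_M(ς) − d_M(ς)) dς + μ²σ(s) − ∫_{s−τ(s)}^s d_I(ς) dς ) ds, where σ(s) = ∫_{s−τ(s)}^s D_I(ς) dς. -/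
open Real MeasureTheory Set Filter Topology

/-- Convolution of two functions on `ℝ` (with respect to Lebesgue measure). -/
noncomputable def conv (f g : ℝ → ℝ) (x : ℝ) : ℝ := ∫ y, f y * g (x - y)


noncomputable def gk (v x : ℝ) : ℝ := (Real.sqrt (4 * π * v))⁻¹ * Real.exp (-(x ^ 2 / (4 * v)))

lemma gk_aux (a b : ℝ) (ha : 0 < a) :
    Integrable (fun x : ℝ => Real.exp (-a * x ^ 2 + b * x)) ∧
    ∫ x : ℝ, Real.exp (-a * x ^ 2 + b * x) = Real.sqrt (π / a) * Real.exp (b ^ 2 / (4 * a)) := by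
  have e : (fun x : ℝ => Real.exp (-a * x ^ 2 + b * x)) =
      fun x => Real.exp (-a * (x - b / (2 * a)) ^ 2) * Real.exp (b ^ 2 / (4 * a)) := by
    funext x
    rw [← Real.exp_add]
    congr 1
    field_simp
    ring
  rw [e]
  constructor
  · exact ((integrable_exp_neg_mul_sq ha).comp_sub_right (b / (2 * a))).mul_const _
  · rw [integral_mul_const,
      integral_sub_right_eq_self (fun x : ℝ => Real.exp (-a * x ^ 2)) (b / (2 * a)),
      integral_gaussian]

lemma gk_laplace (v μ : ℝ) (hv : 0 < v) :
    Integrable (fun x : ℝ => Real.exp (μ * x) * gk v x) ∧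
    ∫ x : ℝ, Real.exp (μ * x) * gk v x = Real.exp (μ ^ 2 * v) := by
  obtain ⟨i, j⟩ := gk_aux (1 / (4 * v)) μ (by positivity)
  have e : (fun x : ℝ => Real.exp (μ * x) * gk v x) =
      fun x => (Real.sqrt (4 * π * v))⁻¹ * Real.exp (-(1 / (4 * v)) * x ^ 2 + μ * x) := by
    funext x
    rw [gk, mul_left_comm, ← Real.exp_add]
    congr 2
    ring
  rw [e]
  refine ⟨i.const_mul _, ?_⟩
  rw [integral_const_mul, j, ← mul_assoc]
  have h1 : π / (1 / (4 * v)) = 4 * π * v := by field_simp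
  have h2 : μ ^ 2 / (4 * (1 / (4 * v))) = μ ^ 2 * v := by field_simp
  have h3 : Real.sqrt (4 * π * v) ≠ 0 := by positivity
  rw [h1, h2, inv_mul_cancel₀ h3, one_mul]

lemma gk_conv (v w A B : ℝ) (hv : 0 < v) (hw : 0 < w) :
    conv (fun x => A * gk v x) (fun x => B * gk w x) = fun x => (A * B) * gk (v + w) x := by
  funext x
  have j := (gk_aux ((v + w) / (4 * v * w)) (x / (2 * w)) (by positivity)).2
  have e : (fun y : ℝ => A * gk v y * (B * gk w (x - y))) =
      fun y => (A * B * ((Real.sqrt (4 * π * v))⁻¹ * (Real.sqrt (4 * π * w))⁻¹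
        * Real.exp (-(x ^ 2 / (4 * w))))) *
        Real.exp (-((v + w) / (4 * v * w)) * y ^ 2 + x / (2 * w) * y) := by
    funext y
    have : Real.exp (-(y ^ 2 / (4 * v))) * Real.exp (-((x - y) ^ 2 / (4 * w))) =
        Real.exp (-(x ^ 2 / (4 * w))) *
          Real.exp (-((v + w) / (4 * v * w)) * y ^ 2 + x / (2 * w) * y) := by
      rw [← Real.exp_add, ← Real.exp_add]
      congr 1
      field_simp
      ring
    simp only [gk]
    linear_combination (A * B * (Real.sqrt (4 * π * v))⁻¹ * (Real.sqrt (4 * π * w))⁻¹) * this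
  have h3 : Real.exp (-(x ^ 2 / (4 * w))) *
      Real.exp ((x / (2 * w)) ^ 2 / (4 * ((v + w) / (4 * v * w)))) =
      Real.exp (-(x ^ 2 / (4 * (v + w)))) := by
    rw [← Real.exp_add]
    congr 1
    field_simp
    ring
  have h4 : (Real.sqrt (4 * π * v))⁻¹ * (Real.sqrt (4 * π * w))⁻¹ *
      Real.sqrt (π / ((v + w) / (4 * v * w))) = (Real.sqrt (4 * π * (v + w)))⁻¹ := by
    rw [← Real.sqrt_inv, ← Real.sqrt_inv, ← Real.sqrt_inv, ← Real.sqrt_mul (by positivity),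
      ← Real.sqrt_mul (by positivity)]
    congr 1
    field_simp
  rw [conv, e, integral_const_mul, j, gk, ← h3, ← h4]
  ring

lemma gk_fub (α β : ℝ) (hab : α ≤ β) (a V : ℝ → ℝ) (ha : ContinuousOn a (Icc α β))
    (hV : ContinuousOn V (Icc α β)) (hpos : ∀ s ∈ Icc α β, 0 < V s) (μ : ℝ) :
    Integrable (fun y => Real.exp (μ * y) * ∫ s in α..β, a s * gk (V s) y) ∧
    ∫ y, Real.exp (μ * y) * (∫ s in α..β, a s * gk (V s) y) =
      ∫ s in α..β, a s * Real.exp (μ ^ 2 * V s) := by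
  set F : ℝ × ℝ → ℝ := fun p => Real.exp (μ * p.1) * (a p.2 * gk (V p.2) p.1) with hF
  have hnn : ∀ v x, 0 ≤ gk v x := fun v x => by unfold gk; positivity
  have hc : ContinuousOn F (univ ×ˢ Icc α β) := by
    have ha' : ContinuousOn (fun p : ℝ × ℝ => a p.2) (univ ×ˢ Icc α β) :=
      ha.comp continuous_snd.continuousOn (fun p hp => hp.2)
    have hV' : ContinuousOn (fun p : ℝ × ℝ => V p.2) (univ ×ˢ Icc α β) :=
      hV.comp continuous_snd.continuousOn (fun p hp => hp.2)
    have hp' : ∀ p ∈ (univ ×ˢ Icc α β : Set (ℝ × ℝ)), 0 < V p.2 := fun p hp => hpos _ hp.2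
    refine ContinuousOn.mul (by fun_prop) (ha'.mul ?_)
    unfold gk
    refine ContinuousOn.mul (ContinuousOn.inv₀ (Real.continuous_sqrt.comp_continuousOn (continuousOn_const.mul hV')) ?_) ?_
    · intro p hp
      have := hp' p hp
      positivity
    · refine Real.continuous_exp.comp_continuousOn (ContinuousOn.neg ?_)
      refine ContinuousOn.div (by fun_prop) (continuousOn_const.mul hV') ?_
      intro p hp
      have := hp' p hp
      positivity
  have hm : AEStronglyMeasurable F ((volume : Measure ℝ).prod (volume.restrict (Icc α β))) := by
    have := hc.aestronglyMeasurable (μ := (volume : Measure (ℝ × ℝ)))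
      (MeasurableSet.univ.prod measurableSet_Icc)
    rwa [Measure.volume_eq_prod, ← Measure.prod_restrict, Measure.restrict_univ] at this
  have hint : Integrable F ((volume : Measure ℝ).prod (volume.restrict (Icc α β))) := by
    rw [integrable_prod_iff' hm]
    constructor
    · filter_upwards [ae_restrict_mem measurableSet_Icc] with s hs
      refine ((gk_laplace (V s) μ (hpos s hs)).1.const_mul (a s)).congr ?_
      filter_upwards with x
      simp only [hF]
      ring
    · have h : IntegrableOn (fun s => |a s| * Real.exp (μ ^ 2 * V s)) (Icc α β) :=
        ContinuousOn.integrableOn_Icc (by fun_prop)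
      refine Integrable.congr h ?_
      filter_upwards [ae_restrict_mem measurableSet_Icc] with s hs
      rw [← (gk_laplace (V s) μ (hpos s hs)).2, ← integral_const_mul]
      congr 1
      funext x
      simp only [hF, norm_mul, Real.norm_eq_abs, Real.abs_exp, abs_of_nonneg (hnn (V s) x)]
      ring
  have hin : ∀ y, Real.exp (μ * y) * (∫ s in α..β, a s * gk (V s) y) =
      ∫ s in Icc α β, F (y, s) := by
    intro y
    rw [intervalIntegral.integral_of_le hab, ← integral_Icc_eq_integral_Ioc,
      ← integral_const_mul]
  simp_rw [hin]
  refine ⟨hint.integral_prod_left, ?_⟩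
  rw [integral_integral_swap (f := fun y s => F (y, s)) hint,
    intervalIntegral.integral_of_le hab, ← integral_Icc_eq_integral_Ioc]
  refine setIntegral_congr_fun measurableSet_Icc (fun s hs => ?_)
  rw [← (gk_laplace (V s) μ (hpos s hs)).2, ← integral_const_mul]
  congr 1
  funext x
  simp only [hF]
  ring

lemma cont_int (f u v : ℝ → ℝ) (hf : Continuous f) (hu : Continuous u) (hv : Continuous v) :
    Continuous (fun s => ∫ x in (u s)..(v s), f x) := by
  have h : Continuous (fun t => ∫ x in (0:ℝ)..t, f x) :=
    intervalIntegral.continuous_primitive (fun a b => hf.intervalIntegrable a b) 0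
  have e : (fun s => ∫ x in (u s)..(v s), f x) =
      fun s => (∫ x in (0:ℝ)..(v s), f x) - ∫ x in (0:ℝ)..(u s), f x := by
    funext s
    rw [intervalIntegral.integral_interval_sub_left] <;> exact hf.intervalIntegrable _ _
  rw [e]
  exact (h.comp hv).sub (h.comp hu)

/-- Explicit computation of the two-sided Laplace transform of the
linearized invasion kernel `𝒦`. -/
theorem laplace_transform_of_invasion_kernel
    (T tα tβ : ℝ) (h1 : 0 < tα) (h2 : tα ≤ tβ) (h3 : tβ < T)
    (DM DI dM dI : ℝ → ℝ)
    (hDMc : Continuous DM) (hDIc : Continuous DI)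
    (hdMc : Continuous dM) (hdIc : Continuous dI)
    (hDMpos : ∀ s, 0 < DM s) (hDIpos : ∀ s, 0 < DI s)
    (τ : ℝ → ℝ) (hτ : ContDiff ℝ 1 τ)
    (hτord : ∀ s ∈ Icc tα tβ, 0 < s - τ s ∧ s - τ s < s)
    (c : ℝ → ℝ) (hc : ContinuousOn c (Icc tα tβ)) (hcnn : ∀ s ∈ Icc tα tβ, 0 ≤ c s)
    (kM kI : ℝ → ℝ → ℝ → ℝ)
    (hkM : ∀ t s x, kM t s x = (Real.sqrt (4 * π * ∫ ς in s..t, DM ς))⁻¹ *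
      Real.exp (-(x ^ 2 / (4 * ∫ ς in s..t, DM ς)) - ∫ ς in s..t, dM ς))
    (hkI : ∀ t s x, kI t s x = (Real.sqrt (4 * π * ∫ ς in s..t, DI ς))⁻¹ *
      Real.exp (-(x ^ 2 / (4 * ∫ ς in s..t, DI ς)) - ∫ ς in s..t, dI ς))
    (𝒦 : ℝ → ℝ)
    (h𝒦 : ∀ x, 𝒦 x = kM T 0 x +
      ∫ s in tα..tβ, c s * conv (conv (kM T s) (kI s (s - τ s))) (kM (s - τ s) 0) x)
    (σ : ℝ → ℝ) (hσ : ∀ s, σ s = ∫ ς in (s - τ s)..s, DI ς)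
    (μ : ℝ) :
    ∫ y, Real.exp (μ * y) * 𝒦 y =
      Real.exp (∫ ς in (0:ℝ)..T, (μ ^ 2 * DM ς - dM ς)) +
      ∫ s in tα..tβ, c s * Real.exp ((∫ ς in s..T, (μ ^ 2 * DM ς - dM ς)) +
        (∫ ς in (0:ℝ)..(s - τ s), (μ ^ 2 * DM ς - dM ς)) + μ ^ 2 * σ s -
        ∫ ς in (s - τ s)..s, dI ς) := by
  have hτc : Continuous τ := hτ.continuous
  have kMe : ∀ t s, kM t s = fun x => Real.exp (-∫ ς in s..t, dM ς) * gk (∫ ς in s..t, DM ς) x := by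
    intro t s
    funext x
    rw [hkM, gk, sub_eq_add_neg, Real.exp_add]
    ring
  have kIe : ∀ t s, kI t s = fun x => Real.exp (-∫ ς in s..t, dI ς) * gk (∫ ς in s..t, DI ς) x := by
    intro t s
    funext x
    rw [hkI, gk, sub_eq_add_neg, Real.exp_add]
    ring
  have hM : ∀ s t, s < t → 0 < ∫ ς in s..t, DM ς := fun s t h =>
    intervalIntegral.intervalIntegral_pos_of_pos (hDMc.intervalIntegrable _ _) hDMpos h
  have hI : ∀ s t, s < t → 0 < ∫ ς in s..t, DI ς := fun s t h =>
    intervalIntegral.intervalIntegral_pos_of_pos (hDIc.intervalIntegrable _ _) hDIpos h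
  have hlin : ∀ s t, (∫ ς in s..t, (μ ^ 2 * DM ς - dM ς)) =
      μ ^ 2 * (∫ ς in s..t, DM ς) - ∫ ς in s..t, dM ς := by
    intro s t
    rw [intervalIntegral.integral_sub ((hDMc.const_mul _).intervalIntegrable _ _)
      (hdMc.intervalIntegrable _ _), intervalIntegral.integral_const_mul]
  set V : ℝ → ℝ := fun s => (∫ ς in s..T, DM ς) + (∫ ς in (s - τ s)..s, DI ς) +
    ∫ ς in (0:ℝ)..(s - τ s), DM ς with hVdef
  set E : ℝ → ℝ := fun s => Real.exp (-∫ ς in s..T, dM ς) *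
    Real.exp (-∫ ς in (s - τ s)..s, dI ς) * Real.exp (-∫ ς in (0:ℝ)..(s - τ s), dM ς) with hEdef
  have hVc : Continuous V :=
    ((cont_int DM _ _ hDMc continuous_id continuous_const).add
      (cont_int DI _ _ hDIc (continuous_id.sub hτc) continuous_id)).add
      (cont_int DM _ _ hDMc continuous_const (continuous_id.sub hτc))
  have hEc : Continuous E :=
    ((cont_int dM _ _ hdMc continuous_id continuous_const).neg.rexp.mul
      (cont_int dI _ _ hdIc (continuous_id.sub hτc) continuous_id).neg.rexp).mul
      (cont_int dM _ _ hdMc continuous_const (continuous_id.sub hτc)).neg.rexp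
  have hp : ∀ s ∈ Icc tα tβ, 0 < (∫ ς in s..T, DM ς) ∧ 0 < (∫ ς in (s - τ s)..s, DI ς) ∧
      0 < ∫ ς in (0:ℝ)..(s - τ s), DM ς := fun s hs =>
    ⟨hM _ _ (hs.2.trans_lt h3), hI _ _ (hτord s hs).2, hM _ _ (hτord s hs).1⟩
  have hVp : ∀ s ∈ Icc tα tβ, 0 < V s := by
    intro s hs
    obtain ⟨p1, p2, p3⟩ := hp s hs
    simp only [hVdef]
    positivity
  obtain ⟨i2, j2⟩ := gk_fub tα tβ h2 (fun s => c s * E s) V (hc.mul hEc.continuousOn)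
    hVc.continuousOn hVp μ
  have hT : 0 < ∫ ς in (0:ℝ)..T, DM ς := hM _ _ (by linarith)
  obtain ⟨i1, j1⟩ := gk_laplace (∫ ς in (0:ℝ)..T, DM ς) μ hT
  have hK : ∀ y, Real.exp (μ * y) * 𝒦 y =
      Real.exp (-∫ ς in (0:ℝ)..T, dM ς) * (Real.exp (μ * y) * gk (∫ ς in (0:ℝ)..T, DM ς) y) +
      Real.exp (μ * y) * ∫ s in tα..tβ, c s * E s * gk (V s) y := by
    intro y
    rw [h𝒦, mul_add]
    congr 1
    · rw [kMe]
      ring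
    · congr 1
      apply intervalIntegral.integral_congr
      intro s hs
      rw [uIcc_of_le h2] at hs
      obtain ⟨p1, p2, p3⟩ := hp s hs
      simp only
      rw [kMe, kIe, kMe, gk_conv _ _ _ _ p1 p2, gk_conv _ _ _ _ (add_pos p1 p2) p3]
      simp only [hVdef, hEdef]
      ring
  simp_rw [hK]
  rw [integral_add (i1.const_mul _) i2, integral_const_mul, j1, j2, hlin, ← Real.exp_add]
  congr 1
  · congr 1
    ring
  · apply intervalIntegral.integral_congr
    intro s hs
    simp only [hVdef, hEdef]
    rw [hlin, hlin, hσ, mul_assoc, ← Real.exp_add, ← Real.exp_add, ← Real.exp_add]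
    congr 2
    ring
end

section
/- Define Φ(μ) = (1/μ) ln G(μ) for μ > 0. Then Φ(μ) > 0 for every μ > 0, Φ(μ) → +∞ as μ → 0⁺, Φ(μ) → +∞ as μ → +∞, and there exists μ* > 0 such that Φ(μ*) = inf_{μ>0} Φ(μ); in particular the spreading speed c* := inf_{μ>0} Φ(μ) is positive and is attained. -/
open Real MeasureTheory Set Filter Topology

/-- Properties of the speed functional `Φ(μ) = (1/μ) ln G(μ)`:
positivity, divergence at `0⁺` and `+∞`, and attainment of the infimum,
so the spreading speed `c* = inf_{μ>0} Φ(μ)` is positive and attained. -/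
theorem speed_functional_positive_and_attained
    (tα tβ : ℝ) (h1 : 0 < tα) (h2 : tα ≤ tβ)
    (a0 p0 : ℝ) (ha0 : 0 < a0) (hp0 : 0 < p0)
    (a p : ℝ → ℝ)
    (hac : ContinuousOn a (Icc tα tβ)) (hpc : ContinuousOn p (Icc tα tβ))
    (hann : ∀ s ∈ Icc tα tβ, 0 ≤ a s) (hpnn : ∀ s ∈ Icc tα tβ, 0 ≤ p s)
    (G : ℝ → ℝ)
    (hG : ∀ μ, G μ = a0 * Real.exp (p0 * μ ^ 2) +
      ∫ s in tα..tβ, a s * Real.exp (p s * μ ^ 2))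
    (hG0 : 1 < G 0)
    (Φ : ℝ → ℝ) (hΦ : ∀ μ, Φ μ = (1 / μ) * Real.log (G μ)) :
    (∀ μ > 0, 0 < Φ μ) ∧
    Tendsto Φ (nhdsWithin 0 (Ioi 0)) atTop ∧
    Tendsto Φ atTop atTop ∧
    ∃ μs > 0, (∀ μ > 0, Φ μs ≤ Φ μ) ∧ 0 < Φ μs := by
  have hicc : uIcc tα tβ = Icc tα tβ := uIcc_of_le h2
  have hint : ∀ μ : ℝ, IntervalIntegrable (fun s => a s * Real.exp (p s * μ ^ 2)) volume tα tβ := by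
    intro μ
    apply ContinuousOn.intervalIntegrable
    rw [hicc]
    exact hac.mul (hpc.mul continuousOn_const).rexp
  have hGc : Continuous G := by
    have e : G = fun μ => a0 * Real.exp (p0 * μ ^ 2) +
        ∫ s in tα..tβ, IccExtend h2 ((Icc tα tβ).domRestrict a) s *
          Real.exp (IccExtend h2 ((Icc tα tβ).domRestrict p) s * μ ^ 2) := by
      funext μ
      rw [hG]
      congr 1
      apply intervalIntegral.integral_congr
      intro s hs
      rw [hicc] at hs
      simp only [IccExtend_of_mem h2 _ hs, domRestrict_apply]
    have ca : Continuous (IccExtend h2 ((Icc tα tβ).domRestrict a)) :=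
      (continuousOn_iff_continuous_domRestrict.1 hac).Icc_extend'
    have cp : Continuous (IccExtend h2 ((Icc tα tβ).domRestrict p)) :=
      (continuousOn_iff_continuous_domRestrict.1 hpc).Icc_extend'
    rw [e]
    refine Continuous.add (by fun_prop) ?_
    apply intervalIntegral.continuous_parametric_intervalIntegral_of_continuous'
    unfold Function.uncurry
    fun_prop
  have hmono : ∀ μ, G 0 ≤ G μ := by
    intro μ
    rw [hG, hG]
    refine add_le_add ?_ ?_
    · refine mul_le_mul_of_nonneg_left (Real.exp_le_exp.2 ?_) ha0.le
      have := mul_nonneg hp0.le (sq_nonneg μ)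
      simpa using this
    · refine intervalIntegral.integral_mono_on h2 (hint 0) (hint μ) ?_
      intro s hs
      refine mul_le_mul_of_nonneg_left (Real.exp_le_exp.2 ?_) (hann s hs)
      have := mul_nonneg (hpnn s hs) (sq_nonneg μ)
      simpa using this
  have hlow : ∀ μ, a0 * Real.exp (p0 * μ ^ 2) ≤ G μ := by
    intro μ
    rw [hG]
    have : 0 ≤ ∫ s in tα..tβ, a s * Real.exp (p s * μ ^ 2) :=
      intervalIntegral.integral_nonneg h2 fun s hs => mul_nonneg (hann s hs) (Real.exp_pos _).le
    linarith
  have hlog : 0 < Real.log (G 0) := Real.log_pos hG0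
  have hpos : ∀ μ > 0, 0 < Φ μ := by
    intro μ hμ
    rw [hΦ]
    exact mul_pos (by positivity) (Real.log_pos (hG0.trans_le (hmono μ)))
  have ht0 : Tendsto Φ (nhdsWithin 0 (Ioi 0)) atTop := by
    have h : Tendsto (fun μ : ℝ => μ⁻¹ * Real.log (G 0)) (nhdsWithin 0 (Ioi 0)) atTop :=
      tendsto_inv_nhdsGT_zero.atTop_mul_const hlog
    refine tendsto_atTop_mono' _ ?_ h
    filter_upwards [self_mem_nhdsWithin] with μ hμ
    have hμ' : (0:ℝ) < μ := hμ
    rw [hΦ, one_div]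
    exact mul_le_mul_of_nonneg_left (Real.log_le_log (by linarith) (hmono μ)) (by positivity)
  have hti : Tendsto Φ atTop atTop := by
    have h : Tendsto (fun μ : ℝ => μ⁻¹ * Real.log a0 + p0 * μ) atTop atTop :=
      (tendsto_inv_atTop_zero.mul_const (Real.log a0)).add_atTop
        (tendsto_id.const_mul_atTop hp0)
    refine tendsto_atTop_mono' _ ?_ h
    filter_upwards [eventually_gt_atTop 0] with μ hμ
    have h3 := Real.log_le_log (by positivity) (hlow μ)
    rw [Real.log_mul ha0.ne' (Real.exp_pos _).ne', Real.log_exp] at h3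
    rw [hΦ, one_div]
    calc μ⁻¹ * Real.log a0 + p0 * μ = μ⁻¹ * (Real.log a0 + p0 * μ ^ 2) := by
          field_simp
      _ ≤ _ := mul_le_mul_of_nonneg_left h3 (by positivity)
  refine ⟨hpos, ht0, hti, ?_⟩
  obtain ⟨δ, hδ, hδ'⟩ := mem_nhdsGT_iff_exists_Ioo_subset.1 (ht0.eventually_ge_atTop (Φ 1))
  obtain ⟨M, hM⟩ := eventually_atTop.1 (hti.eventually_ge_atTop (Φ 1))
  have hδ0 : (0:ℝ) < δ := hδ
  have hl : 0 < min (δ / 2) 1 := lt_min (by linarith) one_pos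
  have h1K : (1:ℝ) ∈ Icc (min (δ / 2) 1) (max M 1) := ⟨min_le_right _ _, le_max_right _ _⟩
  have hc : ContinuousOn Φ (Icc (min (δ / 2) 1) (max M 1)) := by
    have e : Φ = fun μ => (1 / μ) * Real.log (G μ) := funext hΦ
    rw [e]
    refine ContinuousOn.mul ?_ ?_
    · exact continuousOn_const.div continuousOn_id fun x hx => (hl.trans_le hx.1).ne'
    · exact hGc.continuousOn.log fun x _ => by linarith [hmono x]
  obtain ⟨m, hm, hmin⟩ := isCompact_Icc.exists_isMinOn ⟨1, h1K⟩ hc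
  have hm0 : 0 < m := hl.trans_le hm.1
  refine ⟨m, hm0, ?_, hpos m hm0⟩
  intro μ hμ
  by_cases hK : μ ∈ Icc (min (δ / 2) 1) (max M 1)
  · exact hmin hK
  · refine (show Φ m ≤ Φ 1 from hmin h1K).trans ?_
    by_cases hlt : μ < min (δ / 2) 1
    · exact hδ' ⟨hμ, by linarith [min_le_left (δ / 2) 1]⟩
    · refine hM μ ?_
      by_contra hcon
      exact hK ⟨not_lt.1 hlt, (not_le.1 hcon).le.trans (le_max_left _ _)⟩
end

section
/- Let t_α < t_β, θ₁ ∈ ℝ, θ₂ > 0, and let τ(s) = θ₁ − θ₂ s, so τ'(s) = −θ₂. Set τ_av = θ₁ − θ₂(t_α + t_β)/2 (the average of τ over [t_α, t_β]). Then for every l ∈ ℝ, ∫_{t_α}^{t_β} (1 − τ'(s)) e^{l τ(s)} ds > (t_β − t_α) e^{l τ_av}. -/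
open Real MeasureTheory Set Filter Topology

/-- For a linearly decreasing delay `τ(s) = θ₁ − θ₂s` (`θ₂ > 0`) with average
`τ_av = θ₁ − θ₂(t_α+t_β)/2`, one has
`∫_{t_α}^{t_β} (1 − τ'(s)) e^{lτ(s)} ds > (t_β − t_α) e^{lτ_av}` for every `l ∈ ℝ`. -/
theorem linear_delay_integral_inequality
    (tα tβ θ1 θ2 : ℝ) (h : tα < tβ) (hθ2 : 0 < θ2) (l : ℝ) :
    (tβ - tα) * Real.exp (l * (θ1 - θ2 * (tα + tβ) / 2)) <
      ∫ s in tα..tβ, (1 + θ2) * Real.exp (l * (θ1 - θ2 * s)) := by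
  have hpos := Real.exp_pos (l * (θ1 - θ2 * (tα + tβ) / 2))
  set E := Real.exp (l * (θ1 - θ2 * (tα + tβ) / 2)) with hE
  have key : ∀ s : ℝ, E * (1 + l * θ2 * ((tα + tβ) / 2)) - (E * l * θ2) * s
      ≤ Real.exp (l * (θ1 - θ2 * s)) := by
    intro s
    have h1 := Real.add_one_le_exp (l * θ2 * ((tα + tβ) / 2 - s))
    have h2 : Real.exp (l * (θ1 - θ2 * s)) = E * Real.exp (l * θ2 * ((tα + tβ) / 2 - s)) := by
      rw [hE, ← Real.exp_add]
      congr 1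
      ring
    rw [h2]
    have h3 := mul_le_mul_of_nonneg_left h1 hpos.le
    linarith
  have hint : ∫ s in tα..tβ, (E * (1 + l * θ2 * ((tα + tβ) / 2)) - (E * l * θ2) * s)
      = (tβ - tα) * E := by
    rw [intervalIntegral.integral_sub (by simp)
      ((by fun_prop : Continuous fun s : ℝ => (E * l * θ2) * s).intervalIntegrable _ _),
      intervalIntegral.integral_const, intervalIntegral.integral_const_mul, integral_id]
    simp only [smul_eq_mul]
    ring
  have hle : (tβ - tα) * E ≤ ∫ s in tα..tβ, Real.exp (l * (θ1 - θ2 * s)) := by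
    rw [← hint]
    apply intervalIntegral.integral_mono h.le
    · exact (by fun_prop : Continuous _).intervalIntegrable _ _
    · exact (by fun_prop : Continuous _).intervalIntegrable _ _
    · exact key
  rw [intervalIntegral.integral_const_mul]
  have hp : 0 < (tβ - tα) * E := mul_pos (sub_pos.2 h) hpos
  nlinarith
end

section
/- Let τ(s) = θ₁ − θ₂ s with θ₂ > 0 and τ(s) > 0 on [t_α, t_β], and let τ_av = θ₁ − θ₂(t_α+t_β)/2. Assume G_τ(0) > 1 and G_{τ_av}(0) > 1. Then c*(τ) > c*(τ_av): a linearly decreasing periodic maturation delay gives a strictly larger invasion speed than its average. -/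
open Real MeasureTheory Set Filter Topology

theorem aux_min (G : ℝ → ℝ) (T DM dM : ℝ) (hT : 0 < T) (hDM : 0 < DM)
    (hc : Continuous G) (h0 : 1 < G 0)
    (hG : ∀ μ, Real.exp ((μ ^ 2 * DM - dM) * T) ≤ G μ) :
    ∃ m > 0, ∀ μ > 0, (1 / m) * Real.log (G m) ≤ (1 / μ) * Real.log (G μ) := by
  have hpos : ∀ μ, 0 < G μ := fun μ => lt_of_lt_of_le (Real.exp_pos _) (hG μ)
  have hlog : Continuous (fun μ => Real.log (G μ)) := hc.log (fun μ => (hpos μ).ne')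
  have t0 : Tendsto (fun μ : ℝ => (1 / μ) * Real.log (G μ)) (𝓝[>] 0) atTop := by
    have ha : Tendsto (fun μ : ℝ => 1 / μ) (𝓝[>] 0) atTop := by
      simpa using tendsto_inv_nhdsGT_zero (𝕜 := ℝ)
    exact ha.atTop_mul_pos (Real.log_pos h0) ((hlog.tendsto 0).mono_left nhdsWithin_le_nhds)
  have e0 := t0.eventually (eventually_ge_atTop ((1 / 1) * Real.log (G 1)))
  obtain ⟨δ, hδ, hδ'⟩ := mem_nhdsGT_iff_exists_Ioo_subset.1 e0
  have hδ : 0 < δ := hδ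
  have hlow : ∀ μ > 0, μ * (DM * T) - dM * T / μ ≤ (1 / μ) * Real.log (G μ) := by
    intro μ hμ
    have := (Real.le_log_iff_exp_le (hpos μ)).2 (hG μ)
    calc μ * (DM * T) - dM * T / μ = (1 / μ) * ((μ ^ 2 * DM - dM) * T) := by field_simp
      _ ≤ _ := by gcongr
  have t1 : Tendsto (fun μ : ℝ => μ * (DM * T) - dM * T / μ) atTop atTop := by
    have ha : Tendsto (fun μ : ℝ => μ * (DM * T)) atTop atTop :=
      tendsto_id.atTop_mul_const (by positivity)
    have hb : Tendsto (fun μ : ℝ => -(dM * T / μ)) atTop (𝓝 (-0)) :=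
      (tendsto_const_nhds.div_atTop tendsto_id).neg
    simpa [sub_eq_add_neg] using ha.atTop_add hb
  obtain ⟨R, hR⟩ := eventually_atTop.1
    (t1.eventually (eventually_ge_atTop ((1 / 1) * Real.log (G 1))))
  set a := min (δ / 2) 1
  set b := max R 1
  have hapos : 0 < a := lt_min (by linarith) one_pos
  have ha1 : a ≤ 1 := min_le_right _ _
  have hb1 : 1 ≤ b := le_max_right _ _
  have hcont : ContinuousOn (fun μ : ℝ => (1 / μ) * Real.log (G μ)) (Icc a b) := by
    apply ContinuousOn.mul _ hlog.continuousOn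
    apply ContinuousOn.div continuousOn_const continuousOn_id
    intro x hx
    exact (lt_of_lt_of_le hapos hx.1).ne'
  obtain ⟨m, hm, hmin⟩ := isCompact_Icc.exists_isMinOn ⟨1, ha1, hb1⟩ hcont
  refine ⟨m, lt_of_lt_of_le hapos hm.1, fun μ hμ => ?_⟩
  have hm1 : (1 / m) * Real.log (G m) ≤ (1 / 1) * Real.log (G 1) := hmin ⟨ha1, hb1⟩
  by_cases hμa : μ < a
  · have : μ ∈ Ioo 0 δ := ⟨hμ, by have : a ≤ δ / 2 := min_le_left _ _
                                  linarith⟩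
    exact hm1.trans (hδ' this)
  by_cases hμb : b < μ
  · exact hm1.trans ((hR μ ((le_max_left R 1).trans hμb.le)).trans (hlow μ hμ))
  exact hmin ⟨not_lt.1 hμa, not_lt.1 hμb⟩

theorem aux_jensen (a b E k : ℝ) (hab : a < b) :
    (b - a) * Real.exp E ≤ ∫ s in a..b, Real.exp (E + k * (s - (a + b) / 2)) := by
  have h : ∫ s in a..b, Real.exp E * (1 + k * (s - (a + b) / 2)) = (b - a) * Real.exp E := by
    have : ∀ s : ℝ, Real.exp E * (1 + k * (s - (a + b) / 2))
      = Real.exp E * (1 - k * ((a + b) / 2)) + (Real.exp E * k) * s := fun s => by ring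
    simp_rw [this]
    rw [intervalIntegral.integral_add
      (Continuous.intervalIntegrable (by fun_prop) _ _)
      (Continuous.intervalIntegrable (by fun_prop) _ _),
      intervalIntegral.integral_const, intervalIntegral.integral_const_mul, integral_id,
      smul_eq_mul]
    ring
  rw [← h]
  apply intervalIntegral.integral_mono_on hab.le
  · exact Continuous.intervalIntegrable (by fun_prop) _ _
  · exact Continuous.intervalIntegrable (by fun_prop) _ _
  · intro s _
    rw [Real.exp_add]
    gcongr
    linarith [Real.add_one_le_exp (k * (s - (a + b) / 2))]

/-- A linearly decreasing periodic maturation delay gives a strictly larger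
invasion speed than its average: `c*(τ) > c*(τ_av)`. -/
theorem linear_decreasing_delay_speeds_up_invasion
    (T tα tβ DM DI dM dI q θ1 θ2 : ℝ)
    (h1 : 0 < tα) (h2 : tα < tβ) (h3 : tβ < T)
    (hDM : 0 < DM) (hDI : 0 ≤ DI) (hdM : 0 < dM) (hdI : 0 < dI) (hq : 0 < q)
    (hθ2 : 0 < θ2)
    (τ : ℝ → ℝ) (hτ : ∀ s, τ s = θ1 - θ2 * s)
    (hτpos : ∀ s ∈ Icc tα tβ, 0 < τ s)
    (τav : ℝ) (hτav : τav = θ1 - θ2 * (tα + tβ) / 2)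
    (Gτ Gav : ℝ → ℝ)
    (hGτ : ∀ μ, Gτ μ = Real.exp ((μ ^ 2 * DM - dM) * T) +
      q * ∫ s in tα..tβ, (1 + θ2) *
        Real.exp ((μ ^ 2 * DM - dM) * (T - τ s) + (μ ^ 2 * DI - dI) * τ s))
    (hGav : ∀ μ, Gav μ = Real.exp ((μ ^ 2 * DM - dM) * T) +
      q * ∫ s in tα..tβ,
        Real.exp ((μ ^ 2 * DM - dM) * (T - τav) + (μ ^ 2 * DI - dI) * τav))
    (hGτ0 : 1 < Gτ 0) (hGav0 : 1 < Gav 0)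
    (cτ cav : ℝ)
    (hcτ : cτ = sInf {x | ∃ μ > 0, x = (1 / μ) * Real.log (Gτ μ)})
    (hcav : cav = sInf {x | ∃ μ > 0, x = (1 / μ) * Real.log (Gav μ)}) :
    cav < cτ := by
  have hT : 0 < T := by linarith
  have hτc : Continuous τ := by
    rw [show τ = fun s => θ1 - θ2 * s from funext hτ]; fun_prop
  have hlt : ∀ μ, Gav μ < Gτ μ := by
    intro μ
    rw [hGτ, hGav, intervalIntegral.integral_const_mul]
    have hJ := aux_jensen tα tβ ((μ ^ 2 * DM - dM) * (T - τav) + (μ ^ 2 * DI - dI) * τav)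
      (θ2 * ((μ ^ 2 * DM - dM) - (μ ^ 2 * DI - dI))) h2
    have he : ∀ s, (μ ^ 2 * DM - dM) * (T - τ s) + (μ ^ 2 * DI - dI) * τ s =
      (μ ^ 2 * DM - dM) * (T - τav) + (μ ^ 2 * DI - dI) * τav +
      (θ2 * ((μ ^ 2 * DM - dM) - (μ ^ 2 * DI - dI))) * (s - (tα + tβ) / 2) := by
      intro s
      rw [hτ, hτav]; ring
    simp_rw [he]
    rw [intervalIntegral.integral_const, smul_eq_mul]
    have hp := mul_pos (sub_pos.2 h2)
      (Real.exp_pos ((μ ^ 2 * DM - dM) * (T - τav) + (μ ^ 2 * DI - dI) * τav))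
    refine add_lt_add_right (mul_lt_mul_of_pos_left ?_ hq) _
    nlinarith [mul_pos hθ2 (hp.trans_le hJ)]
  have hcontτ : Continuous Gτ := by
    rw [funext hGτ]
    refine Continuous.add (by fun_prop) (continuous_const.mul ?_)
    apply intervalIntegral.continuous_parametric_intervalIntegral_of_continuous'
    simp only [Function.uncurry_def]
    fun_prop
  have hcontav : Continuous Gav := by
    rw [funext hGav]
    simp only [intervalIntegral.integral_const, smul_eq_mul]
    fun_prop
  have hav : ∀ μ, Real.exp ((μ ^ 2 * DM - dM) * T) ≤ Gav μ := by
    intro μ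
    rw [hGav, intervalIntegral.integral_const, smul_eq_mul]
    have := mul_pos hq (mul_pos (sub_pos.2 h2)
      (Real.exp_pos ((μ ^ 2 * DM - dM) * (T - τav) + (μ ^ 2 * DI - dI) * τav)))
    linarith
  obtain ⟨m, hm, hmin⟩ := aux_min Gτ T DM dM hT hDM hcontτ hGτ0
    (fun μ => (hav μ).trans (hlt μ).le)
  obtain ⟨n, hn, hnmin⟩ := aux_min Gav T DM dM hT hDM hcontav hGav0 hav
  have hle : cav ≤ (1 / m) * Real.log (Gav m) := by
    rw [hcav]
    apply csInf_le
    · refine ⟨(1 / n) * Real.log (Gav n), ?_⟩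
      rintro x ⟨μ, hμ, rfl⟩
      exact hnmin μ hμ
    · exact ⟨m, hm, rfl⟩
  have hge : (1 / m) * Real.log (Gτ m) ≤ cτ := by
    rw [hcτ]
    refine le_csInf ⟨(1 / m) * Real.log (Gτ m), m, hm, rfl⟩ ?_
    rintro x ⟨μ, hμ, rfl⟩
    exact hmin μ hμ
  refine hle.trans_lt (lt_of_lt_of_le ?_ hge)
  have hpos : 0 < Gav m := (Real.exp_pos _).trans_le (hav m)
  exact mul_lt_mul_of_pos_left (Real.log_lt_log hpos (hlt m)) (by positivity)
end

section
/- Fix C > 0 and let Ω be the set of continuous nonnegative functions η on [0,T] with η(0) = η(T) and (1/T)∫_0^T η(s) ds = C. Let η* ∈ Ω satisfy η*(s) = 0 for all s ∈ [α, t_β]. Then for every η ∈ Ω one has G_η(μ) ≥ G_{η*}(μ) for all μ > 0, and consequently c*(η) ≥ c*(η*); in particular the minimum of c* over Ω is attained at any η* ∈ Ω vanishing on [α, t_β]. -/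
open Real MeasureTheory Set Filter Topology

/-- Among extrinsic death rates `η` with fixed yearly average `C`, the
spreading speed is minimized by any `η*` vanishing on `[α, t_β]` (the season with juveniles):
`G_η(μ) ≥ G_{η*}(μ)` for all `μ > 0` and consequently `c*(η) ≥ c*(η*)`. -/
theorem optimal_extrinsic_death_rate
    (T α β tα tβ C : ℝ)
    (hα : 0 < α) (hαβ : α ≤ β) (hβtα : β < tα) (htαβ : tα ≤ tβ) (htβT : tβ < T)
    (hC : 0 < C)
    (τ : ℝ → ℝ) (hτ : ContDiff ℝ 1 τ) (hτ' : ∀ s, deriv τ s < 1)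
    (hτr : ∀ s ∈ Icc tα tβ, α ≤ s - τ s ∧ s - τ s ≤ β)
    (𝒟 𝒹 : ℝ) (h𝒟 : 0 < 𝒟)
    (r : ℝ → ℝ) (hrc : ContinuousOn r (Icc tα tβ)) (hrnn : ∀ s ∈ Icc tα tβ, 0 ≤ r s)
    (A B : ℝ → ℝ) (hAc : ContinuousOn A (Icc tα tβ)) (hAnn : ∀ s ∈ Icc tα tβ, 0 ≤ A s)
    (hBc : ContinuousOn B (Icc tα tβ))
    (G : (ℝ → ℝ) → ℝ → ℝ)
    (hG : ∀ η μ, G η μ = Real.exp (μ ^ 2 * 𝒟 - 𝒹 - T * C) +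
      ∫ s in tα..tβ, r s *
        Real.exp (μ ^ 2 * A s - B s - T * C + ∫ ς in (s - τ s)..s, η ς))
    (cs : (ℝ → ℝ) → ℝ)
    (hcs : ∀ η, cs η = sInf {x | ∃ μ > 0, x = (1 / μ) * Real.log (G η μ)})
    (Ω : Set (ℝ → ℝ))
    (hΩ : Ω = {η | ContinuousOn η (Icc 0 T) ∧ (∀ s ∈ Icc 0 T, 0 ≤ η s) ∧
      η 0 = η T ∧ (1 / T) * ∫ s in (0:ℝ)..T, η s = C})
    (ηs : ℝ → ℝ) (hηs : ηs ∈ Ω) (hηs0 : ∀ s ∈ Icc α tβ, ηs s = 0) :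
    (∀ η ∈ Ω, ∀ μ > 0, G ηs μ ≤ G η μ) ∧ (∀ η ∈ Ω, cs ηs ≤ cs η) := by
  subst hΩ
  have hT : (0:ℝ) < T := by linarith
  have hsub : ∀ s ∈ Icc tα tβ, s ∈ Icc 0 T ∧ s - τ s ∈ Icc 0 T ∧ s - τ s ≤ s := by
    intro s hs
    obtain ⟨h1, h2⟩ := hτr s hs
    obtain ⟨h3, h4⟩ := hs
    exact ⟨⟨by linarith, by linarith⟩, ⟨by linarith, by linarith⟩, by linarith⟩
  -- continuity of the integrand
  have hcont : ∀ η : ℝ → ℝ, ContinuousOn η (Icc 0 T) → ∀ μ : ℝ,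
      ContinuousOn (fun s => r s *
        Real.exp (μ ^ 2 * A s - B s - T * C + ∫ ς in (s - τ s)..s, η ς)) (Icc tα tβ) := by
    intro η hη μ
    have hint : IntegrableOn η (uIcc 0 T) := by
      rw [uIcc_of_le hT.le]
      exact hη.integrableOn_Icc
    have hP : ContinuousOn (fun x => ∫ ς in (0:ℝ)..x, η ς) (Icc 0 T) := by
      have := intervalIntegral.continuousOn_primitive_interval hint
      rwa [uIcc_of_le hT.le] at this
    have hI : ContinuousOn (fun s => ∫ ς in (s - τ s)..s, η ς) (Icc tα tβ) := by
      have h1 : ContinuousOn (fun s => ∫ ς in (0:ℝ)..s, η ς) (Icc tα tβ) :=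
        hP.mono (fun s hs => (hsub s hs).1)
      have h2 : ContinuousOn (fun s => ∫ ς in (0:ℝ)..(s - τ s), η ς) (Icc tα tβ) :=
        hP.comp (f := fun s => s - τ s) (continuous_id.sub hτ.continuous).continuousOn
          (fun s hs => (hsub s hs).2.1)
      refine (h1.sub h2).congr ?_
      intro s hs
      have hii : ∀ x ∈ Icc 0 T, IntervalIntegrable η volume 0 x := by
        intro x hx
        apply ContinuousOn.intervalIntegrable
        rw [uIcc_of_le hx.1]
        exact hη.mono (Icc_subset_Icc le_rfl hx.2)
      exact (intervalIntegral.integral_interval_sub_left (hii s (hsub s hs).1)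
        (hii _ (hsub s hs).2.1)).symm
    exact hrc.mul (((((hAc.const_mul (μ ^ 2)).sub hBc).sub continuousOn_const).add hI).rexp)
  have hintg : ∀ η : ℝ → ℝ, ContinuousOn η (Icc 0 T) → ∀ μ : ℝ,
      IntervalIntegrable (fun s => r s *
        Real.exp (μ ^ 2 * A s - B s - T * C + ∫ ς in (s - τ s)..s, η ς)) volume tα tβ := by
    intro η hη μ
    apply ContinuousOn.intervalIntegrable
    rw [uIcc_of_le htαβ]
    exact hcont η hη μ
  have hmono : ∀ η ∈ {η : ℝ → ℝ | ContinuousOn η (Icc 0 T) ∧ (∀ s ∈ Icc 0 T, 0 ≤ η s) ∧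
      η 0 = η T ∧ (1 / T) * ∫ s in (0:ℝ)..T, η s = C}, ∀ μ : ℝ, G ηs μ ≤ G η μ := by
    intro η hη μ
    rw [hG, hG]
    gcongr
    refine intervalIntegral.integral_mono_on htαβ (hintg _ hηs.1 μ) (hintg _ hη.1 μ) ?_
    intro s hs
    have h0 : ∫ ς in (s - τ s)..s, ηs ς = 0 := by
      apply intervalIntegral.integral_zero_ae
      refine Eventually.of_forall (fun x hx => ?_)
      rw [uIoc_of_le (hsub s hs).2.2] at hx
      exact hηs0 x ⟨by linarith [hx.1, (hτr s hs).1], hx.2.trans hs.2⟩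
    have h1 : 0 ≤ ∫ ς in (s - τ s)..s, η ς := by
      apply intervalIntegral.integral_nonneg (hsub s hs).2.2
      intro x hx
      exact hη.2.1 x ⟨(hsub s hs).2.1.1.trans hx.1, hx.2.trans (hsub s hs).1.2⟩
    apply mul_le_mul_of_nonneg_left _ (hrnn s hs)
    apply Real.exp_le_exp.mpr
    linarith
  have hGpos : ∀ η μ, 0 < G η μ := by
    intro η μ
    rw [hG]
    have := Real.exp_pos (μ ^ 2 * 𝒟 - 𝒹 - T * C)
    have h2 : 0 ≤ ∫ s in tα..tβ, r s *
        Real.exp (μ ^ 2 * A s - B s - T * C + ∫ ς in (s - τ s)..s, η ς) :=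
      intervalIntegral.integral_nonneg htαβ
        (fun s hs => mul_nonneg (hrnn s hs) (Real.exp_pos _).le)
    linarith
  have hG0 : ∀ η : ℝ → ℝ, ContinuousOn η (Icc 0 T) → ∀ μ, G η 0 ≤ G η μ := by
    intro η hη μ
    rw [hG, hG]
    apply add_le_add
    · apply Real.exp_le_exp.mpr
      nlinarith [mul_nonneg (sq_nonneg μ) h𝒟.le]
    · refine intervalIntegral.integral_mono_on htαβ (hintg _ hη 0) (hintg _ hη μ) ?_
      intro s hs
      apply mul_le_mul_of_nonneg_left _ (hrnn s hs)
      apply Real.exp_le_exp.mpr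
      nlinarith [mul_nonneg (sq_nonneg μ) (hAnn s hs)]
  obtain ⟨K, hK0, hKD, hKA⟩ : ∃ K : ℝ, 0 < K ∧ 𝒟 ≤ K ∧ ∀ s ∈ Icc tα tβ, A s ≤ K := by
    obtain ⟨M, hM⟩ := isCompact_Icc.bddAbove_image hAc
    refine ⟨max 𝒟 M, lt_max_of_lt_left h𝒟, le_max_left _ _, fun s hs => ?_⟩
    exact (hM (mem_image_of_mem A hs)).trans (le_max_right _ _)
  have hGK : ∀ η : ℝ → ℝ, ContinuousOn η (Icc 0 T) → ∀ μ,
      G η μ ≤ Real.exp (μ ^ 2 * K) * G η 0 := by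
    intro η hη μ
    rw [hG, hG, mul_add, ← intervalIntegral.integral_const_mul]
    apply add_le_add
    · rw [← Real.exp_add]
      apply Real.exp_le_exp.mpr
      nlinarith [mul_le_mul_of_nonneg_left hKD (sq_nonneg μ)]
    · refine intervalIntegral.integral_mono_on htαβ (hintg _ hη μ)
        ((hintg _ hη 0).const_mul _) ?_
      intro s hs
      rw [mul_left_comm, ← Real.exp_add]
      apply mul_le_mul_of_nonneg_left _ (hrnn s hs)
      apply Real.exp_le_exp.mpr
      nlinarith [mul_le_mul_of_nonneg_left (hKA s hs) (sq_nonneg μ)]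
  have hzero : ∀ η : ℝ → ℝ, ContinuousOn η (Icc 0 T) → G η 0 < 1 → cs η = 0 := by
    intro η hη h1
    rw [hcs]
    apply Real.sInf_of_not_bddBelow
    rintro ⟨b, hb⟩
    have hL : Real.log (G η 0) < 0 := Real.log_neg (hGpos η 0) h1
    set L := Real.log (G η 0) with hLdef
    have hden : 0 < K + |b| + 1 := by positivity
    set μ := min 1 (-L / (K + |b| + 1)) with hμ
    have hμ0 : 0 < μ := lt_min one_pos (div_pos (by linarith) hden)
    have hμ1 : μ ≤ 1 := min_le_left _ _
    have hμL : μ * (K + |b| + 1) ≤ -L := by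
      rw [← le_div_iff₀ hden]
      exact min_le_right _ _
    have h2 : b ≤ (1 / μ) * Real.log (G η μ) := hb ⟨μ, hμ0, rfl⟩
    have h3 : Real.log (G η μ) ≤ μ ^ 2 * K + L := by
      have := Real.log_le_log (hGpos η μ) (hGK η hη μ)
      rwa [Real.log_mul (Real.exp_pos _).ne' (hGpos η 0).ne', Real.log_exp] at this
    have h4 : b * μ ≤ Real.log (G η μ) := by
      have := mul_le_mul_of_nonneg_right h2 hμ0.le
      have h5 : (1 / μ) * Real.log (G η μ) * μ = Real.log (G η μ) := by field_simp
      rwa [h5] at this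
    have h6 : μ ^ 2 * K ≤ μ * K := by
      apply mul_le_mul_of_nonneg_right _ hK0.le
      nlinarith
    have h7 : -(|b| * μ) ≤ b * μ := by nlinarith [neg_abs_le b]
    nlinarith
  have hvals : ∀ η : ℝ → ℝ, ContinuousOn η (Icc 0 T) → 1 ≤ G η 0 →
      ∀ x ∈ {x | ∃ μ > 0, x = (1 / μ) * Real.log (G η μ)}, 0 ≤ x := by
    rintro η hη h1 x ⟨μ, hμ, rfl⟩
    exact mul_nonneg (by positivity) (Real.log_nonneg (h1.trans (hG0 η hη μ)))
  refine ⟨fun η hη μ _ => hmono η hη μ, fun η hη => ?_⟩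
  rcases lt_or_ge (G ηs 0) 1 with h | h
  · rw [hzero ηs hηs.1 h]
    rcases lt_or_ge (G η 0) 1 with h' | h'
    · rw [hzero η hη.1 h']
    · rw [hcs]
      exact Real.sInf_nonneg (hvals η hη.1 h')
  · rw [hcs, hcs η]
    refine le_csInf ⟨_, 1, one_pos, rfl⟩ ?_
    rintro x ⟨μ, hμ, rfl⟩
    refine (csInf_le ⟨0, fun y hy => hvals ηs hηs.1 h y hy⟩ ⟨μ, hμ, rfl⟩).trans ?_
    exact mul_le_mul_of_nonneg_left (Real.log_le_log (hGpos _ _) (hmono η hη μ)) (by positivity)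
end

section
/- Assume the instability condition e^{−∫_0^T d(s) ds} + ∫_{t_α}^{t_β} r(s) e^{−F(s)} ds > 1. Then lim_{k→∞} c*(k)/√k = inf_{ν>0} H(ν), where H(ν) = (1/ν) ln( e^{ν²∫_0^T D − ∫_0^T d} + ∫_{t_α}^{t_β} r(s) e^{ν²E(s) − F(s)} ds ), and this limit is a finite positive real number. -/
open Real MeasureTheory Set Filter Topology

lemma aux_prim_cont (T tα tβ : ℝ) (h1 : 0 < tα) (h2 : tα ≤ tβ) (h3 : tβ < T)
    (D : ℝ → ℝ) (hDc : ContinuousOn D (Icc 0 T))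
    (τ : ℝ → ℝ) (hτ : ContDiff ℝ 1 τ)
    (hτord : ∀ s ∈ Icc tα tβ, 0 < s - τ s ∧ s - τ s < s) :
    ContinuousOn (fun s => (∫ ς in s..T, D ς) + ∫ ς in (0:ℝ)..(s - τ s), D ς) (Icc tα tβ) := by
  have hT : (0:ℝ) ≤ T := by linarith
  have hint : IntegrableOn D (uIcc 0 T) := by
    rw [uIcc_of_le hT]
    exact hDc.integrableOn_Icc
  have c1 := intervalIntegral.continuousOn_primitive_interval_left hint
  have c2 := intervalIntegral.continuousOn_primitive_interval hint
  rw [uIcc_of_le hT] at c1 c2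
  have hτc := hτ.continuous
  refine ContinuousOn.add (c1.mono ?_) ?_
  · intro s hs
    exact ⟨by linarith [hs.1], by linarith [hs.2]⟩
  · refine c2.comp (f := fun s => s - τ s) (by fun_prop) ?_
    intro s hs
    have := hτord s hs
    exact ⟨this.1.le, by linarith [hs.2]⟩

lemma aux_prim_nonneg (T tα tβ : ℝ) (h1 : 0 < tα) (h3 : tβ < T)
    (D : ℝ → ℝ) (hDpos : ∀ s ∈ Icc 0 T, 0 < D s)
    (τ : ℝ → ℝ)
    (hτord : ∀ s ∈ Icc tα tβ, 0 < s - τ s ∧ s - τ s < s) (s : ℝ) (hs : s ∈ Icc tα tβ) :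
    0 ≤ (∫ ς in s..T, D ς) + ∫ ς in (0:ℝ)..(s - τ s), D ς := by
  have h := hτord s hs
  refine add_nonneg (intervalIntegral.integral_nonneg (by linarith [hs.2]) ?_)
    (intervalIntegral.integral_nonneg h.1.le ?_)
  · intro u hu
    exact (hDpos u ⟨by linarith [hs.1, hu.1], hu.2⟩).le
  · intro u hu
    exact (hDpos u ⟨hu.1, by linarith [hs.2, hu.2]⟩).le

/-- The abstract limiting argument. -/
lemma aux_limit (g : ℝ → ℝ) (G : ℝ → ℝ → ℝ) (S δ : ℝ) (hδ : 0 < δ)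
    (hlow : ∀ ν > 0, δ * ν ≤ Real.log (g ν))
    (hsq : ∀ k > 0, ∀ ν > 0, Real.log (g ν) ≤ Real.log (G k (ν / √k)) ∧
      Real.log (G k (ν / √k)) ≤ Real.log (g ν) + ν ^ 2 * S / k) :
    Tendsto (fun k => sInf {x | ∃ μ > 0, x = (1 / μ) * Real.log (G k μ)} / √k) atTop
      (nhds (sInf {x | ∃ ν > 0, x = (1 / ν) * Real.log (g ν)})) ∧
    0 < sInf {x | ∃ ν > 0, x = (1 / ν) * Real.log (g ν)} := by
  set A : Set ℝ := {x | ∃ ν > 0, x = (1 / ν) * Real.log (g ν)} with hA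
  have hAne : A.Nonempty := ⟨_, 1, one_pos, rfl⟩
  have hAlow : ∀ x ∈ A, δ ≤ x := by
    rintro x ⟨ν, hν, rfl⟩
    have := hlow ν hν
    rw [one_div, inv_mul_eq_div, le_div_iff₀ hν]
    exact this
  have hAbdd : BddBelow A := ⟨δ, hAlow⟩
  have hApos : δ ≤ sInf A := le_csInf hAne hAlow
  refine ⟨?_, lt_of_lt_of_le hδ hApos⟩
  have hclow : ∀ k > 0, ∀ x ∈ {x | ∃ μ > 0, x = (1 / μ) * Real.log (G k μ)},
      sInf A * √k ≤ x := by
    rintro k hk x ⟨μ, hμ, rfl⟩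
    have hsk : 0 < √k := Real.sqrt_pos.2 hk
    have h := (hsq k hk (μ * √k) (by positivity)).1
    rw [mul_div_cancel_right₀ _ hsk.ne'] at h
    have h2 : sInf A ≤ 1 / (μ * √k) * Real.log (g (μ * √k)) :=
      csInf_le hAbdd ⟨μ * √k, by positivity, rfl⟩
    rw [one_div, inv_mul_eq_div, le_div_iff₀ (by positivity)] at h2
    rw [one_div, inv_mul_eq_div, le_div_iff₀ hμ]
    linarith
  have hcup : ∀ k > 0, ∀ ν > 0, sInf {x | ∃ μ > 0, x = (1 / μ) * Real.log (G k μ)} / √k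
      ≤ (1 / ν) * Real.log (g ν) + ν * S / k := by
    intro k hk ν hν
    have hsk : 0 < √k := Real.sqrt_pos.2 hk
    have h := (hsq k hk ν hν).2
    have h2 : sInf {x | ∃ μ > 0, x = (1 / μ) * Real.log (G k μ)} ≤
        (1 / (ν / √k)) * Real.log (G k (ν / √k)) :=
      csInf_le ⟨_, fun x hx => hclow k hk x hx⟩ ⟨ν / √k, by positivity, rfl⟩
    rw [div_le_iff₀ hsk]
    refine h2.trans ?_
    have h3 : (1 / (ν / √k)) * Real.log (G k (ν / √k)) ≤
        (1 / (ν / √k)) * (Real.log (g ν) + ν ^ 2 * S / k) :=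
      mul_le_mul_of_nonneg_left h (by positivity)
    refine h3.trans (le_of_eq ?_)
    field_simp
  rw [tendsto_order]
  constructor
  · intro a ha
    filter_upwards [eventually_gt_atTop 0] with k hk
    have hsk : 0 < √k := Real.sqrt_pos.2 hk
    refine lt_of_lt_of_le ha ?_
    rw [le_div_iff₀ hsk]
    exact le_csInf ⟨_, 1, one_pos, rfl⟩ (hclow k hk)
  · intro a ha
    obtain ⟨x, ⟨ν, hν, rfl⟩, hx⟩ := exists_lt_of_csInf_lt hAne ha
    have ht : Tendsto (fun k : ℝ => (1 / ν) * Real.log (g ν) + ν * S / k) atTop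
        (nhds ((1 / ν) * Real.log (g ν) + 0)) :=
      tendsto_const_nhds.add (tendsto_const_nhds.div_atTop tendsto_id)
    rw [add_zero] at ht
    filter_upwards [eventually_gt_atTop 0, ht.eventually_lt_const hx] with k hk hk2
    exact (hcup k hk ν hν).trans_lt hk2

lemma aux_lower (A B L : ℝ) (hA : 0 < A) (hB : 0 ≤ B) (hL : 0 < L) (l : ℝ → ℝ)
    (hl1 : ∀ ν > 0, L ≤ l ν) (hl2 : ∀ ν > 0, ν ^ 2 * A - B ≤ l ν) :
    ∃ δ > 0, ∀ ν > 0, δ * ν ≤ l ν := by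
  set t := L / (2 * (L + B)) with ht
  have hLB : 0 < L + B := by linarith
  have ht0 : 0 < t := by positivity
  have htm : t * (L + B) = L / 2 := by rw [ht]; field_simp
  have ht1 : t ≤ 1 := by
    rw [ht, div_le_one (by positivity)]; linarith
  refine ⟨min (L / 2) (t * A), by positivity, fun ν hν => ?_⟩
  have a1 := mul_le_mul_of_nonneg_left (hl1 ν hν) (sub_nonneg.2 ht1)
  have a2 := mul_le_mul_of_nonneg_left (hl2 ν hν) ht0.le
  have m1 := min_le_left (L / 2) (t * A)
  have m2 := min_le_right (L / 2) (t * A)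
  have m0 : 0 < min (L / 2) (t * A) := by positivity
  set m := min (L / 2) (t * A)
  have a3 : L / 2 + t * A * ν ^ 2 ≤ l ν := by nlinarith
  have a4 : m * ν ^ 2 ≤ t * A * ν ^ 2 := mul_le_mul_of_nonneg_right m2 (sq_nonneg _)
  nlinarith [mul_nonneg m0.le (sq_nonneg (ν - 1)), mul_nonneg m0.le hν.le]

/-- As the mature diffusion multiplier `k → ∞`, the spreading speed satisfies
`c*(k)/√k → inf_{ν>0} H(ν)`, a finite positive number. -/
theorem speed_asymptotics_in_diffusion_rate
    (T tα tβ : ℝ) (h1 : 0 < tα) (h2 : tα ≤ tβ) (h3 : tβ < T)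
    (D d : ℝ → ℝ)
    (hDc : ContinuousOn D (Icc 0 T)) (hdc : ContinuousOn d (Icc 0 T))
    (hDpos : ∀ s ∈ Icc 0 T, 0 < D s) (hdpos : ∀ s ∈ Icc 0 T, 0 < d s)
    (τ : ℝ → ℝ) (hτ : ContDiff ℝ 1 τ)
    (hτord : ∀ s ∈ Icc tα tβ, 0 < s - τ s ∧ s - τ s < s)
    (r σ : ℝ → ℝ)
    (hrc : ContinuousOn r (Icc tα tβ)) (hrnn : ∀ s ∈ Icc tα tβ, 0 ≤ r s)
    (hσc : ContinuousOn σ (Icc tα tβ)) (hσnn : ∀ s ∈ Icc tα tβ, 0 ≤ σ s)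
    (E F : ℝ → ℝ)
    (hE : ∀ s, E s = (∫ ς in s..T, D ς) + ∫ ς in (0:ℝ)..(s - τ s), D ς)
    (hF : ∀ s, F s = (∫ ς in s..T, d ς) + ∫ ς in (0:ℝ)..(s - τ s), d ς)
    (G : ℝ → ℝ → ℝ)
    (hG : ∀ k μ, G k μ =
      Real.exp (μ ^ 2 * k * (∫ ς in (0:ℝ)..T, D ς) - ∫ ς in (0:ℝ)..T, d ς)
      + ∫ s in tα..tβ, r s * Real.exp (μ ^ 2 * (k * E s + σ s) - F s))
    (c : ℝ → ℝ)
    (hc : ∀ k, c k = sInf {x | ∃ μ > 0, x = (1 / μ) * Real.log (G k μ)})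
    (H : ℝ → ℝ)
    (hH : ∀ ν, H ν = (1 / ν) * Real.log
      (Real.exp (ν ^ 2 * (∫ ς in (0:ℝ)..T, D ς) - ∫ ς in (0:ℝ)..T, d ς)
        + ∫ s in tα..tβ, r s * Real.exp (ν ^ 2 * E s - F s)))
    (hinst : 1 < Real.exp (-∫ ς in (0:ℝ)..T, d ς)
      + ∫ s in tα..tβ, r s * Real.exp (-F s)) :
    Tendsto (fun k => c k / Real.sqrt k) atTop
      (nhds (sInf {x | ∃ ν > 0, x = H ν})) ∧
    0 < sInf {x | ∃ ν > 0, x = H ν} := by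
  have hT : 0 < T := by linarith
  have hEc : ContinuousOn E (Icc tα tβ) := by
    rw [funext hE]; exact aux_prim_cont T tα tβ h1 h2 h3 D hDc τ hτ hτord
  have hFc : ContinuousOn F (Icc tα tβ) := by
    rw [funext hF]; exact aux_prim_cont T tα tβ h1 h2 h3 d hdc τ hτ hτord
  have hEnn : ∀ s ∈ Icc tα tβ, 0 ≤ E s := fun s hs => by
    rw [hE]; exact aux_prim_nonneg T tα tβ h1 h3 D hDpos τ hτord s hs
  have hA : 0 < ∫ ς in (0:ℝ)..T, D ς :=
    intervalIntegral.intervalIntegral_pos_of_pos_on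
      (ContinuousOn.intervalIntegrable (by rwa [uIcc_of_le hT.le]))
      (fun s hs => hDpos s (Ioo_subset_Icc_self hs)) hT
  have hB : 0 ≤ ∫ ς in (0:ℝ)..T, d ς :=
    intervalIntegral.integral_nonneg hT.le (fun s hs => (hdpos s hs).le)
  generalize (∫ ς in (0:ℝ)..T, D ς) = A at *
  generalize (∫ ς in (0:ℝ)..T, d ς) = B at *
  obtain ⟨S, hS⟩ := (isCompact_Icc.bddAbove_image hσc)
  have hS' : ∀ s ∈ Icc tα tβ, σ s ≤ S := fun s hs => hS (mem_image_of_mem σ hs)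
  have hS0 : 0 ≤ S := (hσnn tα ⟨le_rfl, h2⟩).trans (hS' tα ⟨le_rfl, h2⟩)
  have hii : ∀ f : ℝ → ℝ, ContinuousOn f (Icc tα tβ) →
      IntervalIntegrable (fun s => r s * Real.exp (f s - F s)) volume tα tβ := by
    intro f hf
    apply ContinuousOn.intervalIntegrable
    rw [uIcc_of_le h2]
    exact hrc.mul (hf.sub hFc).rexp
  have hmono : ∀ f f' : ℝ → ℝ, ContinuousOn f (Icc tα tβ) → ContinuousOn f' (Icc tα tβ) →
      (∀ s ∈ Icc tα tβ, f s ≤ f' s) → (∫ s in tα..tβ, r s * Real.exp (f s - F s)) ≤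
        ∫ s in tα..tβ, r s * Real.exp (f' s - F s) := by
    intro f f' hf hf' hff
    refine intervalIntegral.integral_mono_on h2 (hii f hf) (hii f' hf') fun s hs => ?_
    exact mul_le_mul_of_nonneg_left (Real.exp_le_exp.2 (by linarith [hff s hs])) (hrnn s hs)
  have hinn : ∀ f : ℝ → ℝ, 0 ≤ ∫ s in tα..tβ, r s * Real.exp (f s - F s) := fun f =>
    intervalIntegral.integral_nonneg h2 fun s hs => mul_nonneg (hrnn s hs) (Real.exp_pos _).le
  set g : ℝ → ℝ := fun ν => Real.exp (ν ^ 2 * A - B)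
        + ∫ s in tα..tβ, r s * Real.exp (ν ^ 2 * E s - F s) with hg
  have hgpos : ∀ ν, 0 < g ν := fun ν =>
    add_pos_of_pos_of_nonneg (Real.exp_pos _) (hinn fun s => ν ^ 2 * E s)
  have hg1 : ∀ ν, Real.exp (-B) + (∫ s in tα..tβ, r s * Real.exp (-F s)) ≤ g ν := by
    intro ν
    refine add_le_add (Real.exp_le_exp.2 (by nlinarith [mul_nonneg (sq_nonneg ν) hA.le])) ?_
    have := hmono (fun _ => 0) (fun s => ν ^ 2 * E s) continuousOn_const
      (continuousOn_const.mul hEc) (fun s hs => mul_nonneg (sq_nonneg ν) (hEnn s hs))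
    simpa only [zero_sub] using this
  obtain ⟨δ, hδ, hlow⟩ := aux_lower A B _ hA hB (Real.log_pos hinst) (fun ν => Real.log (g ν))
    (fun ν _ => Real.log_le_log (by linarith) (hg1 ν))
    (fun ν _ => by
      rw [Real.le_log_iff_exp_le (hgpos ν)]
      exact le_add_of_nonneg_right (hinn fun s => ν ^ 2 * E s))
  have hcc : c = fun k => sInf {x | ∃ μ > 0, x = (1 / μ) * Real.log (G k μ)} := funext hc
  have hHH : H = fun ν => (1 / ν) * Real.log (g ν) := funext hH
  rw [hcc, hHH]
  refine aux_limit g G S δ hδ hlow fun k hk ν hν => ?_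
  have hGk : G k (ν / √k) = Real.exp (ν ^ 2 * A - B)
      + ∫ s in tα..tβ, r s * Real.exp ((ν ^ 2 * E s + ν ^ 2 / k * σ s) - F s) := by
    have e0 : (ν / √k) ^ 2 = ν ^ 2 / k := by rw [div_pow, Real.sq_sqrt hk.le]
    have e1 : ν ^ 2 / k * k = ν ^ 2 := by field_simp
    have e2 : ∀ s, ν ^ 2 / k * (k * E s + σ s) = ν ^ 2 * E s + ν ^ 2 / k * σ s := fun s => by
      rw [mul_add, ← mul_assoc, e1]
    rw [hG, e0, e1]
    simp only [e2]
  have hc1 : ContinuousOn (fun s => ν ^ 2 * E s) (Icc tα tβ) := continuousOn_const.mul hEc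
  have hc2 : ContinuousOn (fun s => ν ^ 2 * E s + ν ^ 2 / k * σ s) (Icc tα tβ) :=
    hc1.add (continuousOn_const.mul hσc)
  have hc3 : ContinuousOn (fun s => ν ^ 2 * E s + ν ^ 2 / k * S) (Icc tα tβ) :=
    hc1.add continuousOn_const
  have hq : 0 ≤ ν ^ 2 / k := by positivity
  have hle1 : g ν ≤ G k (ν / √k) := by
    rw [hGk]
    exact add_le_add le_rfl (hmono _ _ hc1 hc2 fun s hs =>
      le_add_of_nonneg_right (mul_nonneg hq (hσnn s hs)))
  have hle2 : G k (ν / √k) ≤ g ν * Real.exp (ν ^ 2 / k * S) := by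
    rw [hGk, hg]
    simp only [add_mul]
    refine add_le_add ?_ ?_
    · exact le_mul_of_one_le_right (Real.exp_pos _).le (Real.one_le_exp (mul_nonneg hq hS0))
    · refine (hmono _ _ hc2 hc3 fun s hs => ?_).trans (le_of_eq ?_)
      · have := mul_le_mul_of_nonneg_left (hS' s hs) hq
        linarith
      · rw [← intervalIntegral.integral_mul_const]
        congr 1
        funext s
        rw [mul_assoc, ← Real.exp_add]
        congr 2
        ring
  refine ⟨Real.log_le_log (hgpos ν) hle1, ?_⟩
  have := Real.log_le_log ((hgpos ν).trans_le hle1) hle2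
  rw [Real.log_mul (hgpos ν).ne' (Real.exp_pos _).ne', Real.log_exp] at this
  refine this.trans (le_of_eq ?_)
  ring
end

section
/- For every t ∈ ℝ, ∫_0^T e^{−∫_s^t d_I(ς)dς} B(s) ds = ∫_0^T e^{−∫_s^t d_I(ς)dς} R̄(s) ds, where R̄(s) = (1 − τ'(s)) e^{−∫_{s−τ(s)}^s d_I(ς)dς} B(s − τ(s)) for s ∈ [t_α, t_β] and R̄(s) = 0 for s ∈ [0, T] \ [t_α, t_β]. (Biologically: all newborns become mature within the same year they were born.) -/
open Real MeasureTheory Set Filter Topology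

theorem aux_restrict (f : ℝ → ℝ) (T a b : ℝ) (h0 : 0 ≤ a) (hab : a ≤ b) (hb : b ≤ T)
    (hf : ∀ s ∈ Icc 0 T \ Icc a b, f s = 0) :
    ∫ s in (0:ℝ)..T, f s = ∫ s in a..b, f s := by
  rw [intervalIntegral.integral_of_le (by linarith), intervalIntegral.integral_of_le hab,
    ← integral_Icc_eq_integral_Ioc, ← integral_Icc_eq_integral_Ioc]
  exact setIntegral_eq_of_subset_of_forall_sdiff_eq_zero measurableSet_Icc
    (Icc_subset_Icc h0 hb) hf

/-- Spatially homogeneous conservation equality: for every `t`,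
`∫_0^T e^{−∫_s^t d_I} B(s) ds = ∫_0^T e^{−∫_s^t d_I} R̄(s) ds`, i.e. all newborns
become mature within the same year they were born. -/
theorem homogeneous_conservation_equality
    (T α β tα tβ : ℝ)
    (hα : 0 < α) (hαβ : α ≤ β) (hβtα : β < tα) (htαβ : tα ≤ tβ) (htβT : tβ < T)
    (dI : ℝ → ℝ) (hdIc : Continuous dI)
    (τ : ℝ → ℝ) (hτ : ContDiff ℝ 1 τ) (hτ' : ∀ s, deriv τ s < 1)
    (hτα : tα - τ tα = α) (hτβ : tβ - τ tβ = β)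
    (B : ℝ → ℝ) (hBc : Continuous B)
    (hB0 : ∀ s ∈ Icc 0 α ∪ Icc β T, B s = 0)
    (R : ℝ → ℝ)
    (hR1 : ∀ s ∈ Icc tα tβ,
      R s = (1 - deriv τ s) * Real.exp (-∫ ς in (s - τ s)..s, dI ς) * B (s - τ s))
    (hR2 : ∀ s ∈ Icc 0 T \ Icc tα tβ, R s = 0) :
    ∀ t : ℝ,
      ∫ s in (0:ℝ)..T, Real.exp (-∫ ς in s..t, dI ς) * B s =
      ∫ s in (0:ℝ)..T, Real.exp (-∫ ς in s..t, dI ς) * R s := by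
  intro t
  have hint : ∀ a b, IntervalIntegrable dI volume a b := fun a b => hdIc.intervalIntegrable a b
  have hτd : Differentiable ℝ τ := hτ.differentiable (by norm_num)
  have hτc : Continuous (deriv τ) := hτ.continuous_deriv (by norm_num)
  rw [aux_restrict _ T α β hα.le hαβ (by linarith), aux_restrict _ T tα tβ (by linarith) htαβ htβT.le]
  · have hg : Continuous (fun s => Real.exp (-∫ ς in s..t, dI ς) * B s) := by
      have h1 : Continuous (fun s => ∫ ς in s..t, dI ς) := by
        have := (intervalIntegral.continuous_primitive hint t).neg
        refine this.congr fun s => ?_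
        simpa using (intervalIntegral.integral_symm (f := dI) (μ := volume) t s).symm
      exact (Real.continuous_exp.comp h1.neg).mul hBc
    have key := intervalIntegral.integral_comp_mul_deriv (a := tα) (b := tβ)
      (f := fun s => s - τ s) (f' := fun s => 1 - deriv τ s)
      (fun x _ => (hasDerivAt_id x).sub (hτd x).hasDerivAt)
      (continuous_const.sub hτc).continuousOn hg
    simp only [hτα, hτβ] at key
    rw [← key]
    refine intervalIntegral.integral_congr fun s hs => ?_
    rw [uIcc_of_le htαβ] at hs
    simp only [Function.comp]
    rw [hR1 s hs, ← intervalIntegral.integral_add_adjacent_intervals (hint (s - τ s) s) (hint s t),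
      neg_add, Real.exp_add]
    ring
  · intro s hs
    simp [hR2 s hs]
  · intro s hs
    have : B s = 0 := by
      apply hB0
      rcases le_total s α with h | h
      · exact Or.inl ⟨hs.1.1, h⟩
      · rcases le_total s β with h' | h'
        · exact absurd ⟨h, h'⟩ hs.2
        · exact Or.inr ⟨h', hs.1.2⟩
    simp [this]
end

section
/- For every t > t_β and every x ∈ ℝ, ∫_0^T (k_I(t,s,·) ∗ B(s,·))(x) ds = ∫_0^T (k_I(t,s,·) ∗ R(s,·))(x) ds, where R(s,x) = (1 − τ'(s)) (k_I(s, s−τ(s), ·) ∗ B(s−τ(s), ·))(x) for s ∈ [t_α, t_β] and R(s,·) ≡ 0 for s ∈ [0,T] \ [t_α, t_β]. (This is the conservation equality: all newborns become mature within the same year they were born.) -/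
open Real MeasureTheory Set Filter Topology

theorem aux_gauss (v w : NNReal) (hv : v ≠ 0) (hw : w ≠ 0) (g : ℝ → ℝ) (hg : Continuous g)
    (M : ℝ) (hM : ∀ x, |g x| ≤ M) (x : ℝ) :
    ∫ y, ProbabilityTheory.gaussianPDFReal 0 v y *
      (∫ z, ProbabilityTheory.gaussianPDFReal 0 w z * g (x - y - z)) =
    ∫ y, ProbabilityTheory.gaussianPDFReal 0 (v + w) y * g (x - y) := by
  have hvw : v + w ≠ 0 := by
    intro h
    exact hv (add_eq_zero.mp h).1
  have h1 := ProbabilityTheory.integral_gaussianReal_eq_integral_smul (μ := 0) hvw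
    (f := fun y => g (x - y))
  simp only [smul_eq_mul] at h1
  rw [← h1]
  have h2 : ∀ y, ∫ z, ProbabilityTheory.gaussianPDFReal 0 w z * g (x - y - z) =
      ∫ z, g (x - (y + z)) ∂(ProbabilityTheory.gaussianReal 0 w) := by
    intro y
    rw [ProbabilityTheory.integral_gaussianReal_eq_integral_smul hw]
    simp only [smul_eq_mul, sub_sub]
  simp only [h2]
  have h3 := ProbabilityTheory.integral_gaussianReal_eq_integral_smul (μ := 0) hv
    (f := fun y => ∫ z, g (x - (y + z)) ∂(ProbabilityTheory.gaussianReal 0 w))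
  simp only [smul_eq_mul] at h3
  rw [← h3]
  have h4 := ProbabilityTheory.gaussianReal_conv_gaussianReal (m₁ := 0) (m₂ := 0) (v₁ := v)
    (v₂ := w)
  rw [add_zero] at h4
  rw [← h4, MeasureTheory.integral_conv]
  refine Integrable.of_bound (C := M) ?_ ?_
  · exact Continuous.aestronglyMeasurable (by fun_prop)
  · exact Eventually.of_forall fun y => hM _

theorem aux_kernel (D d : ℝ) (hD : 0 < D) (x : ℝ) :
    (Real.sqrt (4 * π * D))⁻¹ * Real.exp (-(x ^ 2 / (4 * D)) - d) =
      Real.exp (-d) * ProbabilityTheory.gaussianPDFReal 0 (Real.toNNReal (2 * D)) x := by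
  rw [ProbabilityTheory.gaussianPDFReal, Real.coe_toNNReal _ (by positivity), sub_eq_add_neg,
    Real.exp_add]
  have e1 : 2 * π * (2 * D) = 4 * π * D := by ring
  have e2 : -(x - 0) ^ 2 / (2 * (2 * D)) = -(x ^ 2 / (4 * D)) := by
    rw [sub_zero, neg_div]; congr 2; ring
  rw [e1, e2]; ring

theorem aux_conv (D₁ D₂ d₁ d₂ : ℝ) (h₁ : 0 < D₁) (h₂ : 0 < D₂) (g : ℝ → ℝ) (hg : Continuous g)
    (M : ℝ) (hM : ∀ x, |g x| ≤ M) (x : ℝ) :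
    ∫ y, ((Real.sqrt (4 * π * D₁))⁻¹ * Real.exp (-(y ^ 2 / (4 * D₁)) - d₁)) *
      (∫ z, ((Real.sqrt (4 * π * D₂))⁻¹ * Real.exp (-(z ^ 2 / (4 * D₂)) - d₂)) * g (x - y - z)) =
    ∫ y, ((Real.sqrt (4 * π * (D₂ + D₁)))⁻¹ *
      Real.exp (-(y ^ 2 / (4 * (D₂ + D₁))) - (d₂ + d₁))) * g (x - y) := by
  simp only [aux_kernel _ _ h₁, aux_kernel _ _ h₂, aux_kernel _ _ (add_pos h₂ h₁)]
  have e : Real.toNNReal (2 * (D₂ + D₁)) = Real.toNNReal (2 * D₁) + Real.toNNReal (2 * D₂) := by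
    rw [← Real.toNNReal_add (by positivity) (by positivity)]; congr 1; ring
  have key := aux_gauss (Real.toNNReal (2 * D₁)) (Real.toNNReal (2 * D₂))
    (by simpa using h₁) (by simpa using h₂) g hg M hM x
  rw [e]
  simp only [mul_assoc, integral_const_mul]
  rw [← key, neg_add, Real.exp_add, mul_assoc, ← integral_const_mul, ← integral_const_mul,
    ← integral_const_mul]
  congr 1
  ext y
  ring

/-- Spatial conservation equality: for every `t > t_β` and `x`,
`∫_0^T (k_I(t,s,·) ∗ B(s,·))(x) ds = ∫_0^T (k_I(t,s,·) ∗ R(s,·))(x) ds`,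
where `R` is the recruitment built from `B` by evolving newborns to maturation. -/
theorem spatial_conservation_equality
    (T α β tα tβ : ℝ)
    (hα : 0 < α) (hαβ : α ≤ β) (hβtα : β < tα) (htαβ : tα ≤ tβ) (htβT : tβ < T)
    (DI dI : ℝ → ℝ) (hDIc : Continuous DI) (hdIc : Continuous dI)
    (hDIpos : ∀ s, 0 < DI s)
    (kI : ℝ → ℝ → ℝ → ℝ)
    (hkI : ∀ t s x, kI t s x = (Real.sqrt (4 * π * ∫ ς in s..t, DI ς))⁻¹ *
      Real.exp (-(x ^ 2 / (4 * ∫ ς in s..t, DI ς)) - ∫ ς in s..t, dI ς))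
    (τ : ℝ → ℝ) (hτ : ContDiff ℝ 1 τ) (hτ' : ∀ s, deriv τ s < 1)
    (hτα : tα - τ tα = α) (hτβ : tβ - τ tβ = β)
    (B : ℝ → ℝ → ℝ) (hBc : Continuous fun q : ℝ × ℝ => B q.1 q.2)
    (hBbdd : ∃ M, ∀ s x, |B s x| ≤ M)
    (hB0 : ∀ s ∈ Icc 0 α ∪ Icc β T, ∀ x, B s x = 0)
    (R : ℝ → ℝ → ℝ)
    (hR1 : ∀ s ∈ Icc tα tβ, ∀ x,
      R s x = (1 - deriv τ s) * ∫ y, kI s (s - τ s) y * B (s - τ s) (x - y))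
    (hR2 : ∀ s ∈ Icc 0 T \ Icc tα tβ, ∀ x, R s x = 0) :
    ∀ t > tβ, ∀ x : ℝ,
      ∫ s in (0:ℝ)..T, (∫ y, kI t s y * B s (x - y)) =
      ∫ s in (0:ℝ)..T, (∫ y, kI t s y * R s (x - y)) := by
  intro t ht x
  obtain ⟨M, hM⟩ := hBbdd
  have hT : (0:ℝ) ≤ T := by linarith
  have hτd : Differentiable ℝ τ := hτ.differentiable (by norm_num)
  have hder : ∀ s, HasDerivAt (fun s => s - τ s) (1 - deriv τ s) s := fun s =>
    (hasDerivAt_id s).sub (hτd s).hasDerivAt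
  have hmono : StrictMono (fun s => s - τ s) := by
    refine strictMono_of_deriv_pos fun s => ?_
    rw [(hder s).deriv]
    linarith [hτ' s]
  have hcont : Continuous (fun s => s - τ s) := continuous_id.sub hτ.continuous
  have himg : (fun s => s - τ s) '' Icc tα tβ = Icc α β := by
    apply Subset.antisymm
    · rintro _ ⟨s, hs, rfl⟩
      have h1 := hmono.monotone hs.1
      have h2 := hmono.monotone hs.2
      simp only [hτα, hτβ] at h1 h2
      exact ⟨h1, h2⟩
    · have := intermediate_value_Icc htαβ hcont.continuousOn
      simp only [hτα, hτβ] at this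
      exact this
  rw [intervalIntegral.integral_of_le hT, intervalIntegral.integral_of_le hT]
  have hL : ∫ s in Ioc 0 T, (∫ y, kI t s y * B s (x - y)) =
      ∫ s in Icc α β, (∫ y, kI t s y * B s (x - y)) := by
    refine setIntegral_eq_of_subset_of_forall_sdiff_eq_zero measurableSet_Ioc ?_ ?_
    · intro s hs
      exact ⟨by linarith [hs.1], by linarith [hs.2]⟩
    · rintro s ⟨hs, hs'⟩
      have : s ∈ Icc 0 α ∪ Icc β T := by
        rcases le_or_gt s α with h | h
        · exact Or.inl ⟨hs.1.le, h⟩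
        · refine Or.inr ⟨?_, hs.2⟩
          by_contra h'
          exact hs' ⟨h.le, (not_le.mp h').le⟩
      simp [hB0 s this]
  have hRr : ∫ s in Ioc 0 T, (∫ y, kI t s y * R s (x - y)) =
      ∫ s in Icc tα tβ, (∫ y, kI t s y * R s (x - y)) := by
    refine setIntegral_eq_of_subset_of_forall_sdiff_eq_zero measurableSet_Ioc ?_ ?_
    · intro s hs
      exact ⟨by linarith [hs.1], by linarith [hs.2]⟩
    · rintro s ⟨hs, hs'⟩
      simp [hR2 s ⟨⟨hs.1.le, hs.2⟩, hs'⟩]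
  rw [hL, hRr, ← himg, integral_image_eq_integral_abs_deriv_smul measurableSet_Icc
    (fun s _ => (hder s).hasDerivWithinAt) hmono.injective.injOn]
  refine setIntegral_congr_fun measurableSet_Icc fun s hs => ?_
  have hu : s - τ s ∈ Icc α β := himg ▸ mem_image_of_mem _ hs
  have hus : s - τ s < s := by linarith [hu.2, hs.1]
  have hst : s < t := lt_of_le_of_lt hs.2 ht
  have hii : ∀ a b, IntervalIntegrable DI volume a b := fun a b => hDIc.intervalIntegrable a b
  have hii' : ∀ a b, IntervalIntegrable dI volume a b := fun a b => hdIc.intervalIntegrable a b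
  have p1 : 0 < ∫ ς in s..t, DI ς :=
    intervalIntegral.intervalIntegral_pos_of_pos (hii _ _) hDIpos hst
  have p2 : 0 < ∫ ς in (s - τ s)..s, DI ς :=
    intervalIntegral.intervalIntegral_pos_of_pos (hii _ _) hDIpos hus
  have key := aux_conv _ _ (∫ ς in s..t, dI ς) (∫ ς in (s - τ s)..s, dI ς) p1 p2
    (B (s - τ s)) (hBc.comp (by fun_prop : Continuous fun z : ℝ => (s - τ s, z))) M (hM _) x
  rw [intervalIntegral.integral_add_adjacent_intervals (hii _ _) (hii _ _),
    intervalIntegral.integral_add_adjacent_intervals (hii' _ _) (hii' _ _)] at key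
  simp only [← hkI] at key
  simp only [smul_eq_mul, hR1 s hs]
  rw [abs_of_pos (by linarith [hτ' s]), ← key, ← integral_const_mul]
  congr 1
  ext y
  ring
end

section
/- Define V(t, ξ) = ∫_0^t (k_I(t,s,·) ∗ Z(s,·))(ξ + ct) ds for t > 0 and ξ ∈ ℝ. Then V(t + T, ξ) = V(t, ξ) for all t > 0 and ξ ∈ ℝ; that is, the wave profile of the immature population is T-periodic in time. -/
open Real MeasureTheory Set Filter Topology

/-- The immature wave profile
`V(t,ξ) = ∫_0^t (k_I(t,s,·) ∗ Z(s,·))(ξ + ct) ds` is `T`-periodic in `t`, given the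
traveling-periodicity of `Z` and the conservation property. -/
theorem immature_wave_profile_is_time_periodic
    (T c : ℝ) (hT : 0 < T)
    (DI dI : ℝ → ℝ) (hDIc : Continuous DI) (hdIc : Continuous dI)
    (hDIpos : ∀ t, 0 < DI t) (hdIpos : ∀ t, 0 < dI t)
    (hDIper : ∀ t, DI (t + T) = DI t) (hdIper : ∀ t, dI (t + T) = dI t)
    (kI : ℝ → ℝ → ℝ → ℝ)
    (hkI : ∀ t s x, kI t s x = (Real.sqrt (4 * π * ∫ ς in s..t, DI ς))⁻¹ *
      Real.exp (-(x ^ 2 / (4 * ∫ ς in s..t, DI ς)) - ∫ ς in s..t, dI ς))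
    (Z : ℝ → ℝ → ℝ) (hZc : Continuous fun q : ℝ × ℝ => Z q.1 q.2)
    (hZbdd : ∃ M, ∀ s x, |Z s x| ≤ M)
    (hZper : ∀ s x, Z (s + T) (x + c * T) = Z s x)
    (hcons : ∀ t > T, ∀ y : ℝ, ∫ s in (0:ℝ)..T, (∫ z, kI t s z * Z s (y - z)) = 0)
    (V : ℝ → ℝ → ℝ)
    (hV : ∀ t ξ, V t ξ = ∫ s in (0:ℝ)..t, (∫ y, kI t s y * Z s (ξ + c * t - y))) :
    ∀ t > (0:ℝ), ∀ ξ : ℝ, V (t + T) ξ = V t ξ := by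
  intro t ht ξ
  have hper : ∀ f : ℝ → ℝ, (∀ t, f (t + T) = f t) → ∀ s t : ℝ,
      ∫ ς in (s + T)..(t + T), f ς = ∫ ς in s..t, f ς := by
    intro f hf s t
    rw [← intervalIntegral.integral_comp_add_right]
    simp only [hf]
  have hkper : ∀ t s x, kI (t + T) (s + T) x = kI t s x := by
    intro t s x
    rw [hkI, hkI, hper DI hDIper, hper dI hdIper]
  obtain ⟨M, hM⟩ := hZbdd
  have hM0 : 0 ≤ M := (abs_nonneg _).trans (hM 0 0)
  have hmeas : ∀ t y : ℝ, StronglyMeasurable fun s => ∫ z, kI t s z * Z s (y - z) := by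
    intro t y
    have hprim : ∀ f : ℝ → ℝ, Continuous f → Continuous fun s => ∫ ς in s..t, f ς := by
      intro f hf
      have h1 := intervalIntegral.continuous_primitive
        (fun a b => hf.intervalIntegrable (μ := volume) a b) t
      have : (fun s => ∫ ς in s..t, f ς) = fun s => - ∫ ς in t..s, f ς := by
        funext s
        exact intervalIntegral.integral_symm _ _
      rw [this]
      exact h1.neg
    have hA := (hprim DI hDIc).measurable
    have hB := (hprim dI hdIc).measurable
    have hA' : Measurable fun p : ℝ × ℝ => ∫ ς in p.1..t, DI ς := hA.comp measurable_fst
    have hB' : Measurable fun p : ℝ × ℝ => ∫ ς in p.1..t, dI ς := hB.comp measurable_fst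
    have hZ' : Measurable fun p : ℝ × ℝ => Z p.1 (y - p.2) := by
      have : Continuous fun p : ℝ × ℝ => Z p.1 (y - p.2) :=
        hZc.comp (f := fun p : ℝ × ℝ => (p.1, y - p.2)) (by fun_prop)
      exact this.measurable
    have hF : Measurable fun p : ℝ × ℝ => kI t p.1 p.2 * Z p.1 (y - p.2) := by
      simp only [hkI]
      refine Measurable.mul (Measurable.mul ?_ ?_) hZ'
      · exact (Real.continuous_sqrt.measurable.comp (hA'.const_mul (4 * π))).inv
      · exact Real.measurable_exp.comp
          ((((measurable_snd.pow_const 2).div (hA'.const_mul 4)).neg).sub hB')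
    exact hF.stronglyMeasurable.integral_prod_right'
  have hbound : ∀ t s y : ℝ, s ≤ t → ‖∫ z, kI t s z * Z s (y - z)‖ ≤ M := by
    intro t s y hst
    rcases hst.eq_or_lt with rfl | hlt
    · simpa [hkI] using hM0
    have hA : 0 < ∫ ς in s..t, DI ς :=
      intervalIntegral.intervalIntegral_pos_of_pos (hDIc.intervalIntegrable _ _) hDIpos hlt
    have hB : 0 ≤ ∫ ς in s..t, dI ς :=
      intervalIntegral.integral_nonneg hst fun u _ => (hdIpos u).le
    set A := ∫ ς in s..t, DI ς with hAdef
    set B := ∫ ς in s..t, dI ς with hBdef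
    have hk : ∀ z, kI t s z = ((√(4 * π * A))⁻¹ * Real.exp (-B)) *
        Real.exp (-(1 / (4 * A)) * z ^ 2) := by
      intro z
      rw [hkI, ← hAdef, ← hBdef, mul_assoc _ (Real.exp _) (Real.exp _), ← Real.exp_add]
      congr 2
      ring
    have hb : 0 < 1 / (4 * A) := by positivity
    have hint : Integrable (kI t s) := by
      have := (integrable_exp_neg_mul_sq hb).const_mul ((√(4 * π * A))⁻¹ * Real.exp (-B))
      exact this.congr (Eventually.of_forall fun z => (hk z).symm)
    have hval : ∫ z, kI t s z = Real.exp (-B) := by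
      simp only [hk]
      rw [integral_const_mul, integral_gaussian]
      have : π / (1 / (4 * A)) = 4 * π * A := by field_simp
      rw [this]
      have h0 : √(4 * π * A) ≠ 0 := by positivity
      field_simp
    have hk0 : ∀ z, 0 ≤ kI t s z := by
      intro z
      rw [hk]
      positivity
    calc ‖∫ z, kI t s z * Z s (y - z)‖ ≤ ∫ z, kI t s z * M := by
          refine norm_integral_le_of_norm_le (hint.mul_const M) (Eventually.of_forall fun z => ?_)
          rw [norm_mul, Real.norm_of_nonneg (hk0 z)]
          exact mul_le_mul_of_nonneg_left (hM _ _) (hk0 z)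
      _ = Real.exp (-B) * M := by rw [integral_mul_const, hval]
      _ ≤ 1 * M := by
          gcongr
          exact Real.exp_le_one_iff.2 (by linarith)
      _ = M := one_mul M
  have hii : ∀ t y a b : ℝ, a ≤ t → b ≤ t →
      IntervalIntegrable (fun s => ∫ z, kI t s z * Z s (y - z)) volume a b := by
    intro t y a b ha hb
    refine (intervalIntegrable_const (c := M) (μ := volume)).mono_fun
      (hmeas t y).aestronglyMeasurable ?_
    refine (ae_restrict_iff' measurableSet_uIoc).2 (Eventually.of_forall fun s hs => ?_)
    rw [Real.norm_of_nonneg hM0]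
    exact hbound t s y (hs.2.trans (max_le ha hb))
  rw [hV, hV, ← intervalIntegral.integral_add_adjacent_intervals
    (hii (t + T) (ξ + c * (t + T)) 0 T (by linarith) (by linarith))
    (hii (t + T) (ξ + c * (t + T)) T (t + T) (by linarith) (by linarith)),
    hcons (t + T) (by linarith), zero_add]
  have hs := intervalIntegral.integral_comp_add_right (a := 0) (b := t)
    (fun s => ∫ z, kI (t + T) s z * Z s (ξ + c * (t + T) - z)) T
  rw [zero_add] at hs
  rw [← hs]
  congr 1
  funext s
  congr 1
  funext z
  rw [hkper, ← hZper s]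
  congr 2
  ring
end
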